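/- There exist universal constants c, C > 0 with the following property. Let n ≥ 1 and let S ⊆ ℝ^n be a Borel set with S ∩ (−S) = ∅ and 0 < Vol_n(S) ≤ n/30. Let μ be any SL_n(ℝ)-invariant Borel probability measure on the space 𝒳_n of covolume-one lattices in ℝ^n. Then μ({L ∈ 𝒳_n : there exists an integer k with 1 ≤ k ≤ n/10 and d_k(L ∩ S) > 0}) ≤ C·e^{−c·n}, where the event is restricted to those L for which L ∩ S is finite (which holds for μ-almost every L). -/

import Mathlib

open MeasureTheory Pointwise
open scoped ENNReal

noncomputable section

/-- `SL(n, ℝ)`, the special linear group of `n × n` real matrices of determinant one. -/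
abbrev SLR (n : ℕ) := Matrix.SpecialLinearGroup (Fin n) ℝ

/-- The topology on `SL(n, ℝ)` induced from the space of matrices. -/
instance (n : ℕ) : TopologicalSpace (SLR n) :=
  TopologicalSpace.induced (fun g => (g : Matrix (Fin n) (Fin n) ℝ)) inferInstance

/-- The subgroup `SL(n, ℤ)` of `SL(n, ℝ)` (the range of the coefficient-wise
integer-to-real map on special linear groups). -/
def SLZ (n : ℕ) : Subgroup (SLR n) :=
  MonoidHom.range (Matrix.SpecialLinearGroup.map (n := Fin n) (Int.castRingHom ℝ))

/-- The space `𝒳ₙ = SL(n, ℝ) / SL(n, ℤ)` of lattices of covolume one in `ℝⁿ`. -/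
def LatticeSpace (n : ℕ) := SLR n ⧸ SLZ n

instance (n : ℕ) : TopologicalSpace (LatticeSpace n) :=
  inferInstanceAs (TopologicalSpace (SLR n ⧸ SLZ n))

/-- The Borel σ-algebra on the space of lattices. -/
instance (n : ℕ) : MeasurableSpace (LatticeSpace n) := borel _

/-- The action of `SL(n, ℝ)` on the space of lattices, `g.L = {g x : x ∈ L}`. -/
instance (n : ℕ) : MulAction (SLR n) (LatticeSpace n) :=
  inferInstanceAs (MulAction (SLR n) (SLR n ⧸ SLZ n))

/-- The lattice `{g v : v ∈ ℤⁿ} ⊆ ℝⁿ` associated to a point of `LatticeSpace n`,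
computed via a representative `g` of the coset (the resulting set of vectors does not
depend on the choice of representative, since `SL(n, ℤ)` preserves `ℤⁿ`). -/
def latticeOf {n : ℕ} (L : LatticeSpace n) : Set (Fin n → ℝ) :=
  {y | ∃ v : Fin n → ℤ,
    y = (Quotient.out (α := SLR n) L).1.mulVec (fun i => (v i : ℝ))}

/-- A set `X ⊆ ℝⁿ` consists of linearly independent vectors. -/
def indepSet {n : ℕ} (X : Set (Fin n → ℝ)) : Prop :=
  LinearIndependent ℝ (fun x : X => (x : Fin n → ℝ))

/-- `rank X`: the dimension of the linear span of `X ⊆ ℝⁿ`. -/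
def rankOf {n : ℕ} (X : Set (Fin n → ℝ)) : ℕ :=
  Module.finrank ℝ ↥(Submodule.span ℝ X)

/-- `d_k(A)`: the number of subsets `Y ⊆ A` of cardinality `k` that consist of linearly
independent vectors and are contained in a strictly larger subset `X ⊆ A` whose rank
equals `k`. -/
def dCount {n : ℕ} (k : ℕ) (A : Set (Fin n → ℝ)) : ℕ :=
  Set.ncard {Y : Set (Fin n → ℝ) | Y ⊆ A ∧ Y.ncard = k ∧ indepSet Y ∧
    ∃ X : Set (Fin n → ℝ), Y ⊂ X ∧ X ⊆ A ∧ rankOf X = k}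

open scoped NNReal

/-- A continuous, everywhere positive probability density on the real line. -/
structure IsPosDensity (F : ℝ → ℝ) : Prop where
  continuous : Continuous F
  pos : ∀ x, 0 < F x
  integrable : Integrable F
  integral_eq_one : ∫ x, F x = 1

/-- The distribution function of a density. -/
def distribFun (F : ℝ → ℝ) (x : ℝ) : ℝ := ∫ t in Set.Iic x, F t

namespace IsPosDensity

variable {F : ℝ → ℝ}

theorem hasDerivAt_distribFun (hF : IsPosDensity F) (x : ℝ) :
    HasDerivAt (distribFun F) (F x) x := by
  have h1 : distribFun F = fun u => (∫ t in Set.Iic (0 : ℝ), F t) + ∫ t in (0 : ℝ)..u, F t := by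
    funext u
    rw [← intervalIntegral.integral_Iic_sub_Iic hF.integrable.integrableOn
      hF.integrable.integrableOn]
    simp [distribFun]
  rw [h1]
  exact (intervalIntegral.integral_hasDerivAt_right (hF.continuous.intervalIntegrable _ _)
    (hF.continuous.stronglyMeasurableAtFilter _ _) hF.continuous.continuousAt).const_add _

theorem strictMono_distribFun (hF : IsPosDensity F) : StrictMono (distribFun F) :=
  strictMono_of_hasDerivAt_pos hF.hasDerivAt_distribFun hF.pos

theorem continuous_distribFun (hF : IsPosDensity F) : Continuous (distribFun F) :=
  continuous_iff_continuousAt.2 fun x => (hF.hasDerivAt_distribFun x).continuousAt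

theorem range_distribFun (hF : IsPosDensity F) : Set.range (distribFun F) = Set.Ioo 0 1 := by
  have hbot : Filter.Tendsto (distribFun F) Filter.atBot (nhds 0) := by
    have := tendsto_setIntegral_of_antitone (μ := volume) (f := F)
      (s := fun i : ℝᵒᵈ => Set.Iic (OrderDual.ofDual i)) (fun i => measurableSet_Iic)
      (fun i j h => Set.Iic_subset_Iic.2 h) ⟨0, hF.integrable.integrableOn⟩
    have h0 : (⋂ i : ℝᵒᵈ, Set.Iic (OrderDual.ofDual i)) = (∅ : Set ℝ) := by
      ext x
      simp only [Set.mem_iInter, Set.mem_Iic, Set.mem_empty_iff_false, iff_false, not_forall,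
        not_le]
      exact ⟨OrderDual.toDual (x - 1), by simp⟩
    rw [h0, Measure.restrict_empty, integral_zero_measure] at this
    exact this
  have htop : Filter.Tendsto (distribFun F) Filter.atTop (nhds 1) := by
    have := tendsto_setIntegral_of_monotone (μ := volume) (f := F)
      (s := fun i : ℝ => Set.Iic i) (fun i => measurableSet_Iic)
      (fun i j h => Set.Iic_subset_Iic.2 h) hF.integrable.integrableOn
    rw [Set.iUnion_Iic, Measure.restrict_univ, hF.integral_eq_one] at this
    exact this
  apply Set.Subset.antisymm
  · rintro _ ⟨x, rfl⟩
    constructor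
    · exact lt_of_le_of_lt (hF.strictMono_distribFun.monotone.le_of_tendsto hbot (x - 1))
        (hF.strictMono_distribFun (by linarith))
    · exact lt_of_lt_of_le (hF.strictMono_distribFun (show x < x + 1 by linarith))
        (hF.strictMono_distribFun.monotone.ge_of_tendsto htop (x + 1))
  · intro p hp
    obtain ⟨a, ha⟩ := (hbot.eventually (gt_mem_nhds hp.1)).exists
    obtain ⟨b, hb⟩ := (htop.eventually (lt_mem_nhds hp.2)).exists
    exact mem_range_of_exists_le_of_exists_ge hF.continuous_distribFun ⟨a, ha.le⟩ ⟨b, hb.le⟩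

/-- Monotone transport of one density to another. -/
theorem exists_transport {G : ℝ → ℝ} (hF : IsPosDensity F) (hG : IsPosDensity G) :
    ∃ T : ℝ → ℝ, StrictMono T ∧ ∀ x, HasDerivAt T (F x / G (T x)) x := by
  have hex : ∀ x, ∃ t, distribFun G t = distribFun F x := fun x => by
    have : distribFun F x ∈ Set.range (distribFun G) := by
      rw [hG.range_distribFun, ← hF.range_distribFun]; exact ⟨x, rfl⟩
    exact this
  choose T hT using hex
  have hmono : StrictMono T := fun x y hxy => by
    rw [← hG.strictMono_distribFun.lt_iff_lt, hT, hT]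
    exact hF.strictMono_distribFun hxy
  have hsurj : Function.Surjective T := fun t => by
    have : distribFun G t ∈ Set.range (distribFun F) := by
      rw [hF.range_distribFun, ← hG.range_distribFun]; exact ⟨t, rfl⟩
    obtain ⟨x, hx⟩ := this
    exact ⟨x, hG.strictMono_distribFun.injective (by rw [hT, hx])⟩
  refine ⟨T, hmono, fun x => ?_⟩
  let ψ : ℝ → ℝ := Function.invFun (distribFun G)
  have hψ : ∀ t, ψ (distribFun G t) = t :=
    Function.leftInverse_invFun hG.strictMono_distribFun.injective
  have hψmono : StrictMonoOn ψ (Set.Ioo 0 1) := by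
    rw [← hG.range_distribFun]
    rintro _ ⟨a, rfl⟩ _ ⟨b, rfl⟩ hab
    rw [hψ, hψ]
    exact hG.strictMono_distribFun.lt_iff_lt.1 hab
  have hmem : distribFun F x ∈ Set.Ioo (0 : ℝ) 1 := by
    rw [← hF.range_distribFun]; exact ⟨x, rfl⟩
  have himage : ψ '' Set.Ioo 0 1 = Set.univ := by
    rw [← hG.range_distribFun, ← Set.range_comp]
    exact Set.range_eq_univ.2 fun t => ⟨t, hψ t⟩
  have hψc : ContinuousAt ψ (distribFun F x) :=
    hψmono.continuousAt_of_image_mem_nhds (Ioo_mem_nhds hmem.1 hmem.2)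
      (by rw [himage]; exact Filter.univ_mem)
  have hTψ : T = ψ ∘ distribFun F := by
    funext y
    rw [Function.comp_apply, ← hT, hψ]
  have hψx : ψ (distribFun F x) = T x := by rw [hTψ]; rfl
  have hψd : HasDerivAt ψ (G (T x))⁻¹ (distribFun F x) := by
    refine HasDerivAt.of_local_left_inverse hψc ?_ (hG.pos _).ne'
      (f := distribFun G) ?_
    · rw [hψx]; exact hG.hasDerivAt_distribFun _
    · filter_upwards [Ioo_mem_nhds hmem.1 hmem.2] with p hp
      rw [← hG.range_distribFun] at hp
      obtain ⟨t, rfl⟩ := hp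
      rw [hψ]
  have := hψd.comp x (hF.hasDerivAt_distribFun x)
  rw [hTψ, div_eq_inv_mul, Function.comp_apply, hψx]
  exact this

end IsPosDensity

/-- The density of the centred Gaussian of variance `1/2`. -/
def gaussDensity (t : ℝ) : ℝ := (√Real.pi)⁻¹ * Real.exp (-1 * t ^ 2)

theorem isPosDensity_gaussDensity : IsPosDensity gaussDensity where
  continuous := by unfold gaussDensity; fun_prop
  pos x := by unfold gaussDensity; positivity
  integrable := (integrable_exp_neg_mul_sq one_pos).const_mul _
  integral_eq_one := by
    unfold gaussDensity
    rw [integral_const_mul, integral_gaussian]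
    have : √Real.pi ≠ 0 := by positivity
    simp [this]

theorem mul_rpow_two_thirds_le {a b c : ℝ} (ha : 0 ≤ a) (hb : 0 ≤ b) (hc : 0 ≤ c) :
    (a * b * c) ^ (2 / 3 : ℝ) ≤ (a * b + a * c + b * c) / 3 := by
  have h := Real.geom_mean_le_arith_mean3_weighted (w₁ := 1 / 3) (w₂ := 1 / 3) (w₃ := 1 / 3)
    (by norm_num) (by norm_num) (by norm_num) (mul_nonneg ha hb) (mul_nonneg ha hc)
    (mul_nonneg hb hc) (by norm_num)
  rw [← Real.mul_rpow (by positivity) (by positivity),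
    ← Real.mul_rpow (by positivity) (by positivity)] at h
  have h2 : a * b * (a * c) * (b * c) = (a * b * c) ^ (2 : ℝ) := by
    rw [Real.rpow_two]; ring
  rw [h2, ← Real.rpow_mul (by positivity)] at h
  norm_num at h ⊢
  linarith

theorem integral_gaussian_quadratic :
    ∫⁻ p : ℝ × ℝ, ENNReal.ofReal
        ((3 * Real.pi)⁻¹ * Real.exp (-(4 / 9) * (p.1 ^ 2 - p.1 * p.2 + p.2 ^ 2)))
      = ENNReal.ofReal (√3 / 2) := by
  rw [Measure.volume_eq_prod, lintegral_prod_symm _ (by fun_prop)]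
  have h1 : ∀ y : ℝ, ∫⁻ x : ℝ, ENNReal.ofReal
      ((3 * Real.pi)⁻¹ * Real.exp (-(4 / 9) * (x ^ 2 - x * y + y ^ 2)))
      = ENNReal.ofReal (((3 * Real.pi)⁻¹ * √(Real.pi / (4 / 9))) *
          Real.exp (-(1 / 3) * y ^ 2)) := by
    intro y
    have h2 : ∀ x : ℝ, (3 * Real.pi)⁻¹ * Real.exp (-(4 / 9) * (x ^ 2 - x * y + y ^ 2))
        = ((3 * Real.pi)⁻¹ * Real.exp (-(1 / 3) * y ^ 2)) *
          Real.exp (-(4 / 9) * (x - y / 2) ^ 2) := by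
      intro x
      rw [mul_assoc, ← Real.exp_add]
      congr 2
      ring
    simp_rw [h2]
    rw [← ofReal_integral_eq_lintegral_ofReal, integral_const_mul,
      integral_sub_right_eq_self (fun x : ℝ => Real.exp (-(4 / 9) * x ^ 2)), integral_gaussian]
    · congr 1; ring
    · exact ((integrable_exp_neg_mul_sq (by norm_num : (0 : ℝ) < 4 / 9)).comp_sub_right
        (y / 2)).const_mul _
    · exact Filter.Eventually.of_forall fun x => by positivity
  simp_rw [h1]
  rw [← ofReal_integral_eq_lintegral_ofReal, integral_const_mul, integral_gaussian]
  · congr 1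
    rw [mul_assoc, ← Real.sqrt_mul (by positivity)]
    have : Real.pi / (4 / 9) * (Real.pi / (1 / 3)) = (3 * Real.pi / 2) ^ 2 * 3 := by ring
    rw [this, Real.sqrt_mul (by positivity), Real.sqrt_sq (by positivity)]
    field_simp
  · exact (integrable_exp_neg_mul_sq (by norm_num : (0 : ℝ) < 1 / 3)).const_mul _
  · exact Filter.Eventually.of_forall fun x => by positivity

theorem gaussDensity_mul_rpow_le (a b d : ℝ) :
    (gaussDensity a * gaussDensity b * gaussDensity d) ^ (2 / 3 : ℝ) / 3 ≤
      (3 * Real.pi)⁻¹ * Real.exp (-(4 / 9) *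
        ((a + d) ^ 2 - (a + d) * (b + d) + (b + d) ^ 2)) := by
  have hpi := Real.pi_pos
  have h1 : gaussDensity a * gaussDensity b * gaussDensity d =
      Real.pi ^ (-(3 / 2) : ℝ) * Real.exp (-(a ^ 2 + b ^ 2 + d ^ 2)) := by
    have h3 : (√Real.pi)⁻¹ = Real.pi ^ (-(1 / 2) : ℝ) := by
      rw [Real.rpow_neg hpi.le, Real.sqrt_eq_rpow]
    have h4 : Real.pi ^ (-(3 / 2) : ℝ) = Real.pi ^ (-(1 / 2) : ℝ) * Real.pi ^ (-(1 / 2) : ℝ) *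
        Real.pi ^ (-(1 / 2) : ℝ) := by
      rw [← Real.rpow_add hpi, ← Real.rpow_add hpi]; norm_num
    have h5 : Real.exp (-(a ^ 2 + b ^ 2 + d ^ 2)) =
        Real.exp (-1 * a ^ 2) * Real.exp (-1 * b ^ 2) * Real.exp (-1 * d ^ 2) := by
      rw [← Real.exp_add, ← Real.exp_add]; congr 1; ring
    unfold gaussDensity
    rw [h3, h4, h5]; ring
  rw [h1, Real.mul_rpow (by positivity) (by positivity), ← Real.rpow_mul hpi.le, ← Real.exp_mul]
  have h6 : Real.pi ^ (-(3 / 2) * (2 / 3) : ℝ) = Real.pi⁻¹ := by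
    rw [← Real.rpow_neg_one]; norm_num
  rw [h6, mul_inv, mul_comm (3 : ℝ)⁻¹, mul_assoc, mul_div_assoc]
  refine mul_le_mul_of_nonneg_left ?_ (by positivity)
  rw [div_eq_inv_mul]
  exact mul_le_mul_of_nonneg_left (Real.exp_le_exp.2 (by nlinarith [sq_nonneg (a + b - d)]))
    (by positivity)

/-- The sharp one-dimensional Young inequality with all exponents equal to `3 / 2`, for powers of
densities. -/
theorem IsPosDensity.lintegral_rpow_le {F G H : ℝ → ℝ} (hF : IsPosDensity F)
    (hG : IsPosDensity G) (hH : IsPosDensity H) :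
    ∫⁻ p : ℝ × ℝ, ENNReal.ofReal ((F p.1 * G p.2 * H (p.1 + p.2)) ^ (2 / 3 : ℝ))
      ≤ ENNReal.ofReal (√3 / 2) := by
  obtain ⟨A, hA, hA'⟩ := hF.exists_transport isPosDensity_gaussDensity
  obtain ⟨B, hB, hB'⟩ := hG.exists_transport isPosDensity_gaussDensity
  obtain ⟨D, hD, hD'⟩ := hH.exists_transport isPosDensity_gaussDensity
  let a : ℝ × ℝ → ℝ := fun p => F p.1 / gaussDensity (A p.1)
  let b : ℝ × ℝ → ℝ := fun p => G p.2 / gaussDensity (B p.2)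
  let d : ℝ × ℝ → ℝ := fun p => H (p.1 + p.2) / gaussDensity (D (p.1 + p.2))
  let Θ : ℝ × ℝ → ℝ × ℝ := fun p => (A p.1 + D (p.1 + p.2), B p.2 + D (p.1 + p.2))
  let Θ' : ℝ × ℝ → ℝ × ℝ →L[ℝ] ℝ × ℝ := fun p => LinearMap.toContinuousLinearMap
    (Matrix.toLin (Module.Basis.finTwoProd ℝ) (Module.Basis.finTwoProd ℝ)
      !![a p + d p, d p; d p, b p + d p])
  have hpos := isPosDensity_gaussDensity.pos
  have ha : ∀ p, 0 < a p := fun p => div_pos (hF.pos _) (hpos _)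
  have hb : ∀ p, 0 < b p := fun p => div_pos (hG.pos _) (hpos _)
  have hd : ∀ p, 0 < d p := fun p => div_pos (hH.pos _) (hpos _)
  have hdet : ∀ p, (Θ' p).det = a p * b p + a p * d p + b p * d p := by
    intro p
    simp only [Θ', LinearMap.det_toContinuousLinearMap, LinearMap.det_toLin,
      Matrix.det_fin_two_of]
    ring
  have hder : ∀ p, HasFDerivAt Θ (Θ' p) p := by
    intro p
    have e1 := (hA' p.1).hasFDerivAt.comp p (hasFDerivAt_fst (𝕜 := ℝ) (p := p))
    have e2 := (hB' p.2).hasFDerivAt.comp p (hasFDerivAt_snd (𝕜 := ℝ) (p := p))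
    have e3 := (hD' (p.1 + p.2)).hasFDerivAt.comp p
      ((hasFDerivAt_fst (𝕜 := ℝ) (p := p)).add (hasFDerivAt_snd (𝕜 := ℝ) (p := p)))
    have e : HasFDerivAt Θ _ p := (e1.add e3).prodMk (e2.add e3)
    refine e.congr_fderiv ?_
    simp only [Θ', Matrix.toLin_finTwoProd_toContinuousLinearMap]
    ext <;> simp [a, b, d]
  have hinj : Set.InjOn Θ Set.univ := by
    rintro ⟨x, y⟩ - ⟨x', y'⟩ - h
    simp only [Θ, Prod.mk.injEq] at h
    obtain ⟨h1, h2⟩ := h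
    have key : ∀ x y x' y' : ℝ, A x + D (x + y) = A x' + D (x' + y') →
        B y + D (x + y) = B y' + D (x' + y') → ¬ x < x' := by
      intro x y x' y' h1 h2 hx
      have i1 : A x < A x' := hA hx
      have i2 : x' + y' < x + y := hD.lt_iff_lt.1 (by linarith)
      have i3 : B y' < B y := hB (by linarith)
      have i4 := hD i2
      linarith
    have hx : x = x' := le_antisymm (not_lt.1 (key _ _ _ _ h1.symm h2.symm))
      (not_lt.1 (key _ _ _ _ h1 h2))
    subst hx
    have : D (x + y) = D (x + y') := by linarith
    have := hD.injective this
    ext <;> simp_all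
  have hcv := lintegral_image_eq_lintegral_abs_det_fderiv_mul volume MeasurableSet.univ
    (fun p _ => (hder p).hasFDerivWithinAt) hinj (fun p => ENNReal.ofReal
      ((3 * Real.pi)⁻¹ * Real.exp (-(4 / 9) * (p.1 ^ 2 - p.1 * p.2 + p.2 ^ 2))))
  rw [← integral_gaussian_quadratic]
  refine le_trans ?_ (setLIntegral_le_lintegral (Θ '' Set.univ) _)
  rw [hcv, Measure.restrict_univ]
  refine lintegral_mono fun p => ?_
  rw [← ENNReal.ofReal_mul (abs_nonneg _), hdet]
  refine ENNReal.ofReal_le_ofReal ?_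
  have hfac : F p.1 * G p.2 * H (p.1 + p.2) = (a p * b p * d p) *
      (gaussDensity (A p.1) * gaussDensity (B p.2) * gaussDensity (D (p.1 + p.2))) := by
    have := (hpos (A p.1)).ne'
    have := (hpos (B p.2)).ne'
    have := (hpos (D (p.1 + p.2))).ne'
    simp only [a, b, d]
    field_simp
  have := ha p
  have := hb p
  have := hd p
  have := hpos (A p.1)
  have := hpos (B p.2)
  have := hpos (D (p.1 + p.2))
  rw [hfac, Real.mul_rpow (by positivity) (by positivity), abs_of_nonneg (by positivity)]
  have i1 := mul_rpow_two_thirds_le (ha p).le (hb p).le (hd p).le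
  have i2 := gaussDensity_mul_rpow_le (A p.1) (B p.2) (D (p.1 + p.2))
  calc _ ≤ (a p * b p + a p * d p + b p * d p) / 3 * (gaussDensity (A p.1) *
        gaussDensity (B p.2) * gaussDensity (D (p.1 + p.2))) ^ (2 / 3 : ℝ) := by gcongr
    _ = (a p * b p + a p * d p + b p * d p) * ((gaussDensity (A p.1) *
        gaussDensity (B p.2) * gaussDensity (D (p.1 + p.2))) ^ (2 / 3 : ℝ) / 3) := by ring
    _ ≤ _ := by gcongr

theorem exists_tendsto_isPosDensity {F : ℝ → ℝ≥0∞} (hF : Measurable F) (h1 : ∫⁻ x, F x = 1) :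
    ∃ Φ : ℕ → ℝ → ℝ, (∀ j, IsPosDensity (Φ j)) ∧
      ∀ᵐ x, Filter.Tendsto (fun j => ENNReal.ofReal (Φ j x)) Filter.atTop (nhds (F x)) := by
  have hfin : ∀ᵐ x, F x < ∞ := ae_lt_top hF (by simp [h1])
  have hint : Integrable (fun x => (F x).toReal) :=
    integrable_toReal_of_lintegral_ne_top hF.aemeasurable (by simp [h1])
  have hint1 : ∫ x, (F x).toReal = 1 := by
    rw [integral_toReal hF.aemeasurable hfin, h1, ENNReal.toReal_one]
  have hε : ∀ j : ℕ, (ENNReal.ofReal (1 / ((j : ℝ) + 1))) ≠ 0 := fun j => by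
    simp only [ne_eq, ENNReal.ofReal_eq_zero, not_le]; positivity
  choose φ hφs hφ hφc hφi using fun j : ℕ =>
    hint.exists_hasCompactSupport_lintegral_sub_le (hε j)
  let ψ : ℕ → ℝ → ℝ := fun j x => |φ j x| + 1 / ((j : ℝ) + 1) * gaussDensity x
  have hg := isPosDensity_gaussDensity
  have hψpos : ∀ j x, 0 < ψ j x := fun j x => by
    have := hg.pos x
    simp only [ψ]; positivity
  have hψc : ∀ j, Continuous (ψ j) := fun j => by
    have := hg.continuous
    have := hφc j
    simp only [ψ]; fun_prop
  have hψi : ∀ j, Integrable (ψ j) := fun j => (hφi j).abs.add (hg.integrable.const_mul _)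
  have hle : ∀ j, ∫⁻ x, ‖ψ j x - (F x).toReal‖ₑ ≤ ENNReal.ofReal (2 * (1 / ((j : ℝ) + 1))) := by
    intro j
    have hp : ∀ x, ‖ψ j x - (F x).toReal‖ₑ ≤ ‖(F x).toReal - φ j x‖ₑ +
        ENNReal.ofReal (1 / ((j : ℝ) + 1) * gaussDensity x) := by
      intro x
      rw [← ofReal_norm, ← ofReal_norm, ← ENNReal.ofReal_add (norm_nonneg _)
        (mul_nonneg (by positivity) (hg.pos x).le)]
      refine ENNReal.ofReal_le_ofReal ?_
      have e1 := abs_abs_sub_abs_le (φ j x) (F x).toReal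
      rw [abs_of_nonneg (ENNReal.toReal_nonneg (a := F x))] at e1
      have e2 : 0 ≤ 1 / ((j : ℝ) + 1) * gaussDensity x := mul_nonneg (by positivity) (hg.pos x).le
      simp only [ψ, Real.norm_eq_abs]
      rw [abs_sub_comm (F x).toReal]
      have e3 := abs_add_le (|φ j x| - (F x).toReal) (1 / ((j : ℝ) + 1) * gaussDensity x)
      rw [abs_of_nonneg e2] at e3
      rw [add_sub_right_comm]
      linarith
    refine (lintegral_mono hp).trans ?_
    rw [lintegral_add_right _ (by have := hg.continuous; fun_prop),
      ← ofReal_integral_eq_lintegral_ofReal (hg.integrable.const_mul _)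
      (Filter.Eventually.of_forall fun x => mul_nonneg (by positivity) (hg.pos x).le),
      integral_const_mul, hg.integral_eq_one, two_mul, mul_one,
      ENNReal.ofReal_add (by positivity) (by positivity)]
    gcongr
    exact hφ j
  have hlim : Filter.Tendsto (fun j : ℕ => ENNReal.ofReal (2 * (1 / ((j : ℝ) + 1)))) Filter.atTop
      (nhds 0) := by
    have := (tendsto_one_div_add_atTop_nhds_zero_nat (𝕜 := ℝ)).const_mul 2
    simpa using ENNReal.tendsto_ofReal this
  have hL1 : Filter.Tendsto (fun j => ∫⁻ x, ‖ψ j x - (F x).toReal‖ₑ) Filter.atTop (nhds 0) :=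
    tendsto_of_tendsto_of_tendsto_of_le_of_le tendsto_const_nhds hlim (fun _ => zero_le) hle
  have hZ : Filter.Tendsto (fun j => ∫ x, ψ j x) Filter.atTop (nhds 1) := by
    rw [← hint1]
    exact tendsto_integral_of_L1 _ hint.aestronglyMeasurable (Filter.Eventually.of_forall hψi) hL1
  have hmeas : TendstoInMeasure volume ψ Filter.atTop (fun x => (F x).toReal) := by
    refine tendstoInMeasure_of_tendsto_eLpNorm one_ne_zero (fun j => (hψi j).aestronglyMeasurable)
      hint.aestronglyMeasurable ?_
    simpa [eLpNorm_one_eq_lintegral_enorm] using hL1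
  obtain ⟨ns, hns, hae⟩ := hmeas.exists_seq_tendsto_ae
  have hZpos : ∀ j, 0 < ∫ x, ψ j x := fun j => by
    rw [integral_pos_iff_support_of_nonneg (fun x => (hψpos j x).le) (hψi j)]
    have : Function.support (ψ j) = Set.univ := Set.eq_univ_of_forall fun x => (hψpos j x).ne'
    simp [this]
  refine ⟨fun j x => (∫ x, ψ (ns j) x)⁻¹ * ψ (ns j) x, fun j => ⟨?_, ?_, ?_, ?_⟩, ?_⟩
  · exact (hψc _).const_mul _
  · exact fun x => mul_pos (inv_pos.2 (hZpos _)) (hψpos _ _)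
  · exact (hψi _).const_mul _
  · rw [integral_const_mul, inv_mul_cancel₀ (hZpos _).ne']
  · filter_upwards [hae, hfin] with x hx hxf
    have := ((hZ.comp hns.tendsto_atTop).inv₀ one_ne_zero).mul hx
    rw [inv_one, one_mul] at this
    simpa [ENNReal.ofReal_toReal hxf.ne] using ENNReal.tendsto_ofReal this

/-- The sharp constant in Young's inequality on the line with all exponents `3 / 2`. -/
def youngConst : ℝ≥0∞ := ENNReal.ofReal (√3 / 2)

/-- The `L^{3/2}` norm of a nonnegative function. -/
def normThreeHalves {α : Type*} [MeasureSpace α] (f : α → ℝ≥0∞) : ℝ≥0∞ :=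
  (∫⁻ x, f x ^ (3 / 2 : ℝ)) ^ (2 / 3 : ℝ)

theorem young_real_of_lintegral_eq_one {F G H : ℝ → ℝ≥0∞} (hF : Measurable F)
    (hG : Measurable G) (hH : Measurable H) (hF1 : ∫⁻ x, F x = 1) (hG1 : ∫⁻ x, G x = 1)
    (hH1 : ∫⁻ x, H x = 1) :
    ∫⁻ x, ∫⁻ y, (F x * G y * H (x + y)) ^ (2 / 3 : ℝ) ≤ youngConst := by
  obtain ⟨Φ, hΦ, hΦF⟩ := exists_tendsto_isPosDensity hF hF1
  obtain ⟨Γ, hΓ, hΓG⟩ := exists_tendsto_isPosDensity hG hG1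
  obtain ⟨Ψ, hΨ, hΨH⟩ := exists_tendsto_isPosDensity hH hH1
  have hfinF : ∀ᵐ x, F x < ∞ := ae_lt_top hF (by simp [hF1])
  have hfinG : ∀ᵐ x, G x < ∞ := ae_lt_top hG (by simp [hG1])
  have hfinH : ∀ᵐ x, H x < ∞ := ae_lt_top hH (by simp [hH1])
  rw [← lintegral_prod (μ := volume) (ν := volume)
    (fun p : ℝ × ℝ => (F p.1 * G p.2 * H (p.1 + p.2)) ^ (2 / 3 : ℝ)) (by fun_prop)]
  have hq1 : Measure.QuasiMeasurePreserving (Prod.fst : ℝ × ℝ → ℝ) :=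
    Measure.quasiMeasurePreserving_fst
  have hq2 : Measure.QuasiMeasurePreserving (Prod.snd : ℝ × ℝ → ℝ) :=
    Measure.quasiMeasurePreserving_snd
  have hq3 : Measure.QuasiMeasurePreserving (fun p : ℝ × ℝ => p.1 + p.2) :=
    hq2.comp (measurePreserving_prod_add volume volume).quasiMeasurePreserving
  have hlim : ∀ᵐ p : ℝ × ℝ, Filter.Tendsto (fun j => ENNReal.ofReal
      ((Φ j p.1 * Γ j p.2 * Ψ j (p.1 + p.2)) ^ (2 / 3 : ℝ))) Filter.atTop
      (nhds ((F p.1 * G p.2 * H (p.1 + p.2)) ^ (2 / 3 : ℝ))) := by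
    filter_upwards [hq1.ae (hΦF.and hfinF), hq2.ae (hΓG.and hfinG), hq3.ae (hΨH.and hfinH)]
      with p h1 h2 h3
    have e : ∀ j, ENNReal.ofReal ((Φ j p.1 * Γ j p.2 * Ψ j (p.1 + p.2)) ^ (2 / 3 : ℝ)) =
        (ENNReal.ofReal (Φ j p.1) * ENNReal.ofReal (Γ j p.2) *
          ENNReal.ofReal (Ψ j (p.1 + p.2))) ^ (2 / 3 : ℝ) := by
      intro j
      have i1 := (hΦ j).pos p.1
      have i2 := (hΓ j).pos p.2
      have i3 := (hΨ j).pos (p.1 + p.2)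
      rw [← ENNReal.ofReal_mul i1.le, ← ENNReal.ofReal_mul (by positivity),
        ENNReal.ofReal_rpow_of_nonneg (by positivity) (by norm_num)]
    simp_rw [e]
    refine (ENNReal.continuous_rpow_const.tendsto _).comp ?_
    refine ENNReal.Tendsto.mul (ENNReal.Tendsto.mul h1.1 (Or.inr h2.2.ne) h2.1 (Or.inr h1.2.ne))
      (Or.inr h3.2.ne) h3.1 (Or.inr (ENNReal.mul_lt_top h1.2 h2.2).ne)
  calc ∫⁻ p : ℝ × ℝ, (F p.1 * G p.2 * H (p.1 + p.2)) ^ (2 / 3 : ℝ)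
      = ∫⁻ p : ℝ × ℝ, Filter.liminf (fun j => ENNReal.ofReal
      ((Φ j p.1 * Γ j p.2 * Ψ j (p.1 + p.2)) ^ (2 / 3 : ℝ))) Filter.atTop :=
        lintegral_congr_ae (hlim.mono fun p hp => hp.liminf_eq.symm)
    _ ≤ Filter.liminf (fun j => ∫⁻ p : ℝ × ℝ, ENNReal.ofReal
      ((Φ j p.1 * Γ j p.2 * Ψ j (p.1 + p.2)) ^ (2 / 3 : ℝ))) Filter.atTop := by
        refine lintegral_liminf_le fun j => ?_
        have := (hΦ j).continuous.measurable
        have := (hΓ j).continuous.measurable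
        have := (hΨ j).continuous.measurable
        fun_prop
    _ ≤ youngConst := by
        refine (Filter.liminf_le_liminf (v := fun _ => youngConst)
          (Filter.Eventually.of_forall fun j => ?_)).trans_eq (by simp)
        exact (hΦ j).lintegral_rpow_le (hΓ j) (hΨ j)

theorem normThreeHalves_eq_zero {α : Type*} [MeasureSpace α] {f : α → ℝ≥0∞} (hf : Measurable f)
    (h : normThreeHalves f = 0) : ∀ᵐ x, f x = 0 := by
  rw [normThreeHalves, ENNReal.rpow_eq_zero_iff_of_pos (by norm_num),
    lintegral_eq_zero_iff (by fun_prop)] at h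
  filter_upwards [h] with x hx
  exact (ENNReal.rpow_eq_zero_iff_of_pos (by norm_num)).1 hx

theorem young_real {f g h : ℝ → ℝ≥0∞} (hf : Measurable f) (hg : Measurable g)
    (hh : Measurable h) :
    ∫⁻ x, ∫⁻ y, f x * g y * h (x + y) ≤
      youngConst * (normThreeHalves f * normThreeHalves g * normThreeHalves h) := by
  by_cases hf0 : normThreeHalves f = 0
  · refine le_of_eq_of_le ?_ zero_le
    rw [lintegral_eq_zero_iff (by fun_prop)]
    filter_upwards [normThreeHalves_eq_zero hf hf0] with x hx
    simp [hx]
  by_cases hg0 : normThreeHalves g = 0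
  · refine le_of_eq_of_le ?_ zero_le
    rw [lintegral_eq_zero_iff (by fun_prop)]
    refine Filter.Eventually.of_forall fun x => ?_
    simp only [Pi.zero_apply]
    rw [lintegral_eq_zero_iff (by fun_prop)]
    filter_upwards [normThreeHalves_eq_zero hg hg0] with y hy
    simp [hy]
  by_cases hh0 : normThreeHalves h = 0
  · refine le_of_eq_of_le ?_ zero_le
    rw [lintegral_eq_zero_iff (by fun_prop)]
    refine Filter.Eventually.of_forall fun x => ?_
    simp only [Pi.zero_apply]
    rw [lintegral_eq_zero_iff (by fun_prop)]
    filter_upwards [(measurePreserving_add_left volume x).quasiMeasurePreserving.ae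
      (normThreeHalves_eq_zero hh hh0)] with y hy
    simp [hy]
  have hC : youngConst ≠ 0 := by
    simp only [youngConst, ne_eq, ENNReal.ofReal_eq_zero, not_le]; positivity
  by_cases htop : normThreeHalves f = ∞ ∨ normThreeHalves g = ∞ ∨ normThreeHalves h = ∞
  · refine le_of_le_of_eq le_top ?_
    symm
    rcases htop with ht | ht | ht <;>
      simp [ht, hf0, hg0, hh0, hC, ENNReal.top_mul, ENNReal.mul_top]
  push Not at htop
  obtain ⟨hft, hgt, hht⟩ := htop
  have key : ∀ u : ℝ → ℝ≥0∞, normThreeHalves u ≠ 0 → normThreeHalves u ≠ ∞ →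
      (∀ x, u x = normThreeHalves u *
        ((∫⁻ x, u x ^ (3 / 2 : ℝ))⁻¹ * u x ^ (3 / 2 : ℝ)) ^ (2 / 3 : ℝ)) ∧
      ∫⁻ x, (∫⁻ x, u x ^ (3 / 2 : ℝ))⁻¹ * u x ^ (3 / 2 : ℝ) = 1 := by
    intro u h0 ht
    have i0 : (∫⁻ x, u x ^ (3 / 2 : ℝ)) ≠ 0 := fun h => h0 (by simp [normThreeHalves, h])
    have it : (∫⁻ x, u x ^ (3 / 2 : ℝ)) ≠ ∞ := fun h => ht (by simp [normThreeHalves, h])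
    refine ⟨fun x => ?_, ?_⟩
    · rw [ENNReal.mul_rpow_of_nonneg _ _ (by norm_num), ENNReal.inv_rpow, ← mul_assoc,
        ← normThreeHalves, ENNReal.mul_inv_cancel h0 ht, one_mul, ← ENNReal.rpow_mul]
      norm_num
    · rw [lintegral_const_mul' _ _ (ENNReal.inv_ne_top.2 i0), ENNReal.inv_mul_cancel i0 it]
  obtain ⟨f1, f2⟩ := key f hf0 hft
  obtain ⟨g1, g2⟩ := key g hg0 hgt
  obtain ⟨h1, h2⟩ := key h hh0 hht
  have hy := young_real_of_lintegral_eq_one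
    (F := fun x => (∫⁻ x, f x ^ (3 / 2 : ℝ))⁻¹ * f x ^ (3 / 2 : ℝ))
    (G := fun x => (∫⁻ x, g x ^ (3 / 2 : ℝ))⁻¹ * g x ^ (3 / 2 : ℝ))
    (H := fun x => (∫⁻ x, h x ^ (3 / 2 : ℝ))⁻¹ * h x ^ (3 / 2 : ℝ))
    (by fun_prop) (by fun_prop) (by fun_prop) f2 g2 h2
  have hN : normThreeHalves f * normThreeHalves g * normThreeHalves h ≠ ∞ :=
    ENNReal.mul_ne_top (ENNReal.mul_ne_top hft hgt) hht
  rw [mul_comm youngConst]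
  refine le_trans (le_of_eq ?_) (mul_le_mul_right hy _)
  rw [← lintegral_const_mul' _ _ hN]
  refine lintegral_congr fun x => ?_
  rw [← lintegral_const_mul' _ _ hN]
  refine lintegral_congr fun y => ?_
  rw [ENNReal.mul_rpow_of_nonneg _ _ (by norm_num), ENNReal.mul_rpow_of_nonneg _ _ (by norm_num)]
  conv_lhs => rw [f1 x, g1 y, h1 (x + y)]
  ring

theorem lintegral_fin_succ {α : Type*} [MeasureSpace α] [SigmaFinite (volume : Measure α)] {n : ℕ}
    {f : (Fin (n + 1) → α) → ℝ≥0∞} (hf : Measurable f) :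
    ∫⁻ x, f x = ∫⁻ t : α, ∫⁻ x : Fin n → α, f (Fin.cons t x) := by
  have h := (volume_preserving_piFinSuccAbove (fun _ : Fin (n + 1) => α) 0).symm
  rw [← h.lintegral_comp hf, Measure.volume_eq_prod, lintegral_prod _ (by fun_prop)]
  simp [MeasurableEquiv.piFinSuccAbove, Fin.insertNthEquiv]

/-- Young's inequality on `ℝⁿ` with all exponents `3 / 2` and a constant `< 1`. -/
theorem young_pi {n : ℕ} {f g h : (Fin n → ℝ) → ℝ≥0∞} (hf : Measurable f) (hg : Measurable g)
    (hh : Measurable h) :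
    ∫⁻ x, ∫⁻ y, f x * g y * h (x + y) ≤
      youngConst ^ n * (normThreeHalves f * normThreeHalves g * normThreeHalves h) := by
  induction n with
  | zero =>
    simp only [normThreeHalves, lintegral_unique, pow_zero, one_mul]
    have hv : (volume : Measure (Fin 0 → ℝ)) Set.univ = 1 := by
      rw [volume_pi, Measure.pi_univ]; simp
    simp only [hv, mul_one, ← ENNReal.rpow_mul]
    norm_num
    exact le_of_eq (congrArg _ (congrArg h (Subsingleton.elim _ _)))
  | succ n ih =>
    have hm : ∀ {u : (Fin (n + 1) → ℝ) → ℝ≥0∞}, Measurable u →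
        Measurable fun p : ℝ × (Fin n → ℝ) => u (Fin.cons p.1 p.2) := fun hu =>
      hu.comp (Continuous.finCons continuous_fst continuous_snd).measurable
    let N : ((Fin (n + 1) → ℝ) → ℝ≥0∞) → ℝ → ℝ≥0∞ :=
      fun u t => normThreeHalves fun x : Fin n → ℝ => u (Fin.cons t x)
    have hNm : ∀ {u : (Fin (n + 1) → ℝ) → ℝ≥0∞}, Measurable u → Measurable (N u) := by
      intro u hu
      exact (Measurable.lintegral_prod_right' (f := fun p : ℝ × (Fin n → ℝ) =>
        u (Fin.cons p.1 p.2) ^ (3 / 2 : ℝ)) ((hm hu).pow_const _)).pow_const _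
    have hNN : ∀ {u : (Fin (n + 1) → ℝ) → ℝ≥0∞}, Measurable u →
        normThreeHalves (N u) = normThreeHalves u := by
      intro u hu
      simp only [N, normThreeHalves, ← ENNReal.rpow_mul]
      rw [lintegral_fin_succ (hu.pow_const _)]
      norm_num
    have hadd : ∀ (t s : ℝ) (x y : Fin n → ℝ), (Fin.cons t x + Fin.cons s y : Fin (n + 1) → ℝ) =
        Fin.cons (t + s) (x + y) := fun t s x y => by
      ext i; refine Fin.cases ?_ (fun i => ?_) i <;> simp
    calc ∫⁻ x, ∫⁻ y, f x * g y * h (x + y)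
        = ∫⁻ t : ℝ, ∫⁻ x : Fin n → ℝ, ∫⁻ s : ℝ, ∫⁻ y : Fin n → ℝ,
          f (Fin.cons t x) * g (Fin.cons s y) * h (Fin.cons (t + s) (x + y)) := by
          rw [lintegral_fin_succ (Measurable.lintegral_prod_right' (f := fun p : (Fin (n + 1) → ℝ) ×
            (Fin (n + 1) → ℝ) => f p.1 * g p.2 * h (p.1 + p.2)) (by fun_prop))]
          refine lintegral_congr fun t => lintegral_congr fun x => ?_
          rw [lintegral_fin_succ (by fun_prop)]
          simp_rw [hadd]
      _ = ∫⁻ t : ℝ, ∫⁻ s : ℝ, ∫⁻ x : Fin n → ℝ, ∫⁻ y : Fin n → ℝ,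
          f (Fin.cons t x) * g (Fin.cons s y) * h (Fin.cons (t + s) (x + y)) := by
          refine lintegral_congr fun t => ?_
          refine lintegral_lintegral_swap (f := fun x s => ∫⁻ y : Fin n → ℝ,
            f (Fin.cons t x) * g (Fin.cons s y) * h (Fin.cons (t + s) (x + y)))
            (Measurable.aemeasurable ?_)
          refine Measurable.lintegral_prod_right' (f := fun p : ((Fin n → ℝ) × ℝ) × (Fin n → ℝ) =>
            f (Fin.cons t p.1.1) * g (Fin.cons p.1.2 p.2) *
              h (Fin.cons (t + p.1.2) (p.1.1 + p.2))) ?_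
          refine Measurable.mul (Measurable.mul ?_ ?_) ?_
          · exact (hm hf).comp (g := fun p : ℝ × (Fin n → ℝ) => f (Fin.cons p.1 p.2))
              (f := fun p : ((Fin n → ℝ) × ℝ) × (Fin n → ℝ) => (t, p.1.1)) (by fun_prop)
          · exact (hm hg).comp (g := fun p : ℝ × (Fin n → ℝ) => g (Fin.cons p.1 p.2))
              (f := fun p : ((Fin n → ℝ) × ℝ) × (Fin n → ℝ) => (p.1.2, p.2)) (by fun_prop)
          · exact (hm hh).comp (g := fun p : ℝ × (Fin n → ℝ) => h (Fin.cons p.1 p.2))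
              (f := fun p : ((Fin n → ℝ) × ℝ) × (Fin n → ℝ) => (t + p.1.2, p.1.1 + p.2))
              (by fun_prop)
      _ ≤ ∫⁻ t : ℝ, ∫⁻ s : ℝ, youngConst ^ n * (N f t * N g s * N h (t + s)) := by
          gcongr with t s
          exact ih (f := fun x => f (Fin.cons t x)) (g := fun x => g (Fin.cons s x))
            (h := fun x => h (Fin.cons (t + s) x)) ((hm hf).comp measurable_prodMk_left)
            ((hm hg).comp measurable_prodMk_left) ((hm hh).comp measurable_prodMk_left)
      _ = youngConst ^ n * ∫⁻ t : ℝ, ∫⁻ s : ℝ, N f t * N g s * N h (t + s) := by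
          have hC : youngConst ^ n ≠ ∞ := ENNReal.pow_ne_top ENNReal.ofReal_ne_top
          rw [← lintegral_const_mul' _ _ hC]
          refine lintegral_congr fun t => ?_
          rw [← lintegral_const_mul' _ _ hC]
      _ ≤ youngConst ^ n * (youngConst *
          (normThreeHalves (N f) * normThreeHalves (N g) * normThreeHalves (N h))) := by
          gcongr
          exact young_real (hNm hf) (hNm hg) (hNm hh)
      _ = _ := by rw [hNN hf, hNN hg, hNN hh, pow_succ, mul_assoc (youngConst ^ n)]

/-- The integral over `y ∈ Sᵏ` of the indicator of `w + ∑ aᵢ yᵢ ∈ S`. -/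
def relationVolume {n : ℕ} (S : Set (Fin n → ℝ)) {k : ℕ} (a : Fin k → ℝ) (w : Fin n → ℝ) : ℝ≥0∞ :=
  ∫⁻ y : Fin k → Fin n → ℝ, (∏ i, S.indicator 1 (y i)) * S.indicator 1 (w + ∑ i, a i • y i)

section relationVolume

variable {n : ℕ} {S : Set (Fin n → ℝ)}

theorem normThreeHalves_indicator (hS : MeasurableSet S) :
    normThreeHalves (S.indicator (1 : (Fin n → ℝ) → ℝ≥0∞)) = volume S ^ (2 / 3 : ℝ) := by
  have : (fun x => S.indicator (1 : (Fin n → ℝ) → ℝ≥0∞) x ^ (3 / 2 : ℝ)) = S.indicator 1 := by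
    funext x
    by_cases hx : x ∈ S <;> simp [hx]
  rw [normThreeHalves, this, lintegral_indicator_one hS]

theorem measurePreserving_smul_of_abs_eq_one {ε : ℝ} (hε : |ε| = 1) :
    MeasurePreserving (fun x : Fin n → ℝ => ε • x) volume volume := by
  rcases eq_or_eq_neg_of_abs_eq hε with rfl | rfl
  · simp only [one_smul]
    exact MeasurePreserving.id _
  · simp only [neg_smul, one_smul]
    exact Measure.measurePreserving_neg _

theorem lintegral_indicator_add_le (hS : MeasurableSet S) {ε δ : ℝ} (hε : |ε| = 1) (hδ : |δ| = 1)
    (w : Fin n → ℝ) :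
    ∫⁻ x, ∫⁻ y, S.indicator (1 : (Fin n → ℝ) → ℝ≥0∞) x * S.indicator 1 y *
      S.indicator 1 (w + ε • x + δ • y) ≤ youngConst ^ n * volume S ^ 2 := by
  have hχ : Measurable (S.indicator (1 : (Fin n → ℝ) → ℝ≥0∞)) := measurable_one.indicator hS
  have hinv : ∀ {ε : ℝ}, |ε| = 1 → ∀ x : Fin n → ℝ, ε • ε • x = x := fun {ε} h x => by
    rw [smul_smul, ← abs_mul_abs_self, h]; simp
  have hnorm : ∀ {ε : ℝ}, |ε| = 1 → normThreeHalves
      (fun x => S.indicator (1 : (Fin n → ℝ) → ℝ≥0∞) (ε • x)) = volume S ^ (2 / 3 : ℝ) := by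
    intro ε h
    rw [← normThreeHalves_indicator hS, normThreeHalves, normThreeHalves,
      (measurePreserving_smul_of_abs_eq_one h).lintegral_comp
        (f := fun x => S.indicator (1 : (Fin n → ℝ) → ℝ≥0∞) x ^ (3 / 2 : ℝ)) (by fun_prop)]
  have hw : normThreeHalves (fun x => S.indicator (1 : (Fin n → ℝ) → ℝ≥0∞) (w + x)) =
      volume S ^ (2 / 3 : ℝ) := by
    rw [← normThreeHalves_indicator hS, normThreeHalves, normThreeHalves,
      (measurePreserving_add_left volume w).lintegral_comp
        (f := fun x => S.indicator (1 : (Fin n → ℝ) → ℝ≥0∞) x ^ (3 / 2 : ℝ)) (by fun_prop)]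
  have h := young_pi (f := fun x => S.indicator (1 : (Fin n → ℝ) → ℝ≥0∞) (ε • x))
    (g := fun x => S.indicator 1 (δ • x)) (h := fun x => S.indicator 1 (w + x))
    (by fun_prop) (by fun_prop) (by fun_prop)
  rw [hnorm hε, hnorm hδ, hw] at h
  refine le_trans (le_of_eq ?_) (h.trans (le_of_eq ?_))
  · rw [← (measurePreserving_smul_of_abs_eq_one hε).lintegral_comp
      (Measurable.lintegral_prod_right' (f := fun p : (Fin n → ℝ) × (Fin n → ℝ) =>
        S.indicator (1 : (Fin n → ℝ) → ℝ≥0∞) p.1 * S.indicator 1 p.2 *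
      S.indicator 1 (w + ε • p.1 + δ • p.2)) (by fun_prop))]
    refine lintegral_congr fun x => ?_
    rw [← (measurePreserving_smul_of_abs_eq_one hδ).lintegral_comp (by fun_prop)]
    simp_rw [hinv hε, hinv hδ, add_assoc]
  · congr 1
    rw [← ENNReal.rpow_add_of_nonneg _ _ (by norm_num) (by norm_num),
      ← ENNReal.rpow_add_of_nonneg _ _ (by norm_num) (by norm_num), ← ENNReal.rpow_natCast]
    norm_num

theorem measurable_relationVolume_integrand (hS : MeasurableSet S) {k : ℕ} (a : Fin k → ℝ) :
    Measurable fun p : (Fin n → ℝ) × (Fin k → Fin n → ℝ) =>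
      (∏ i, S.indicator (1 : (Fin n → ℝ) → ℝ≥0∞) (p.2 i)) *
        S.indicator 1 (p.1 + ∑ i, a i • p.2 i) := by
  have hχ : Measurable (S.indicator (1 : (Fin n → ℝ) → ℝ≥0∞)) := measurable_one.indicator hS
  fun_prop

theorem measurable_relationVolume (hS : MeasurableSet S) {k : ℕ} (a : Fin k → ℝ) :
    Measurable (relationVolume S a) :=
  Measurable.lintegral_prod_right' (measurable_relationVolume_integrand hS a)

theorem lintegral_prod_indicator (hS : MeasurableSet S) (k : ℕ) :
    ∫⁻ y : Fin k → Fin n → ℝ, ∏ i, S.indicator (1 : (Fin n → ℝ) → ℝ≥0∞) (y i) = volume S ^ k := by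
  have h : (fun y : Fin k → Fin n → ℝ => ∏ i, S.indicator (1 : (Fin n → ℝ) → ℝ≥0∞) (y i)) =
      (Set.univ.pi fun _ => S).indicator 1 := by
    funext y
    by_cases hy : y ∈ Set.univ.pi fun _ : Fin k => S
    · rw [Set.indicator_of_mem hy]
      exact Finset.prod_eq_one fun i _ => Set.indicator_of_mem (hy i trivial) _
    · rw [Set.indicator_of_notMem hy]
      simp only [Set.mem_univ_pi, not_forall] at hy
      obtain ⟨i, hi⟩ := hy
      exact Finset.prod_eq_zero (Finset.mem_univ i) (Set.indicator_of_notMem hi _)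
  rw [h, lintegral_indicator_one (MeasurableSet.univ_pi fun _ => hS), volume_pi, Measure.pi_pi]
  simp

theorem relationVolume_le_pow (hS : MeasurableSet S) {k : ℕ} (a : Fin k → ℝ) (w : Fin n → ℝ) :
    relationVolume S a w ≤ volume S ^ k := by
  rw [← lintegral_prod_indicator hS]
  refine lintegral_mono fun y => mul_le_of_le_one_right' ?_
  exact Set.indicator_apply_le fun _ => le_rfl

theorem relationVolume_succ (hS : MeasurableSet S) {k : ℕ} (a : Fin (k + 1) → ℝ)
    (w : Fin n → ℝ) :
    relationVolume S a w = ∫⁻ x, S.indicator 1 x * relationVolume S (Fin.tail a) (w + a 0 • x) := by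
  have hm := (measurable_relationVolume_integrand hS a).comp (measurable_prodMk_left (x := w))
  rw [relationVolume, lintegral_fin_succ (by exact hm)]
  refine lintegral_congr fun x => ?_
  rw [relationVolume, ← lintegral_const_mul]
  · refine lintegral_congr fun y => ?_
    simp [Fin.prod_univ_succ, Fin.sum_univ_succ, Fin.tail, mul_assoc, add_assoc]
  · exact (measurable_relationVolume_integrand hS (Fin.tail a)).comp measurable_prodMk_left

theorem lintegral_relationVolume_le (hS : MeasurableSet S) {k : ℕ} {a : Fin k → ℝ}
    (ha : ∀ i, a i = 0 ∨ |a i| = 1) (hne : ∃ i, a i ≠ 0) {ε : ℝ} (hε : |ε| = 1) (w : Fin n → ℝ) :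
    ∫⁻ x, S.indicator 1 x * relationVolume S a (w + ε • x) ≤
      youngConst ^ n * volume S ^ (k + 1) := by
  have hχ : Measurable (S.indicator (1 : (Fin n → ℝ) → ℝ≥0∞)) := measurable_one.indicator hS
  induction k with
  | zero => exact Fin.elim0 hne.choose
  | succ k ih =>
    have hr := measurable_relationVolume hS (Fin.tail a)
    have h1 : ∫⁻ x, S.indicator 1 x * relationVolume S a (w + ε • x) =
        ∫⁻ x, ∫⁻ y, S.indicator 1 x * (S.indicator 1 y *
          relationVolume S (Fin.tail a) (w + ε • x + a 0 • y)) := by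
      refine lintegral_congr fun x => ?_
      rw [relationVolume_succ hS, lintegral_const_mul _ (by fun_prop)]
    rw [h1]
    rcases ha 0 with h0 | h0
    · have hne' : ∃ i, Fin.tail a i ≠ 0 := by
        obtain ⟨i, hi⟩ := hne
        rcases Fin.eq_zero_or_eq_succ i with rfl | ⟨j, rfl⟩
        · exact absurd h0 hi
        · exact ⟨j, hi⟩
      have h2 : ∀ x, ∫⁻ y, S.indicator (1 : (Fin n → ℝ) → ℝ≥0∞) x * (S.indicator 1 y *
          relationVolume S (Fin.tail a) (w + ε • x + a 0 • y)) =
          volume S * (S.indicator 1 x * relationVolume S (Fin.tail a) (w + ε • x)) := by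
        intro x
        simp_rw [h0, zero_smul, add_zero]
        rw [lintegral_const_mul _ (by fun_prop), lintegral_mul_const _ hχ,
          lintegral_indicator_one hS]
        ring
      simp_rw [h2]
      rw [lintegral_const_mul _ (by fun_prop)]
      calc _ ≤ volume S * (youngConst ^ n * volume S ^ (k + 1)) := by
            gcongr
            exact ih (fun i => ha i.succ) hne'
        _ = _ := by ring
    · let P : (Fin k → Fin n → ℝ) → ℝ≥0∞ := fun z => ∏ i, S.indicator 1 (z i)
      let s : (Fin k → Fin n → ℝ) → (Fin n → ℝ) := fun z => ∑ i, Fin.tail a i • z i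
      have hP : Measurable P := by simp only [P]; fun_prop
      have hs : Measurable s := by simp only [s]; fun_prop
      calc _ = ∫⁻ x, ∫⁻ y, ∫⁻ z, P z * (S.indicator 1 x * S.indicator 1 y *
            S.indicator 1 ((w + s z) + ε • x + a 0 • y)) := by
            refine lintegral_congr fun x => lintegral_congr fun y => ?_
            rw [relationVolume, ← lintegral_const_mul, ← lintegral_const_mul]
            · refine lintegral_congr fun z => ?_
              rw [show w + s z + ε • x + a 0 • y = w + ε • x + a 0 • y + s z by abel]
              simp only [P, s]
              ring
            · simp only [s] at hs
              simp only [P] at hP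
              fun_prop
            · simp only [s] at hs
              simp only [P] at hP
              fun_prop
        _ = ∫⁻ x, ∫⁻ z, ∫⁻ y, P z * (S.indicator 1 x * S.indicator 1 y *
            S.indicator 1 ((w + s z) + ε • x + a 0 • y)) := by
            refine lintegral_congr fun x => lintegral_lintegral_swap (Measurable.aemeasurable ?_)
            fun_prop
        _ = ∫⁻ z, ∫⁻ x, ∫⁻ y, P z * (S.indicator 1 x * S.indicator 1 y *
            S.indicator 1 ((w + s z) + ε • x + a 0 • y)) := by
            refine lintegral_lintegral_swap (Measurable.aemeasurable ?_)
            refine Measurable.lintegral_prod_right' (f := fun p :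
              ((Fin n → ℝ) × (Fin k → Fin n → ℝ)) × (Fin n → ℝ) => P p.1.2 *
              (S.indicator 1 p.1.1 * S.indicator 1 p.2 *
                S.indicator 1 ((w + s p.1.2) + ε • p.1.1 + a 0 • p.2))) ?_
            fun_prop
        _ ≤ ∫⁻ z, P z * (youngConst ^ n * volume S ^ 2) := by
            refine lintegral_mono fun z => ?_
            have h3 : ∀ x, ∫⁻ y, P z * (S.indicator (1 : (Fin n → ℝ) → ℝ≥0∞) x * S.indicator 1 y *
              S.indicator 1 ((w + s z) + ε • x + a 0 • y)) = P z * ∫⁻ y, (S.indicator 1 x *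
              S.indicator 1 y * S.indicator 1 ((w + s z) + ε • x + a 0 • y)) := fun x =>
              lintegral_const_mul _ (by fun_prop)
            simp_rw [h3]
            rw [lintegral_const_mul]
            · gcongr
              exact lintegral_indicator_add_le hS hε h0 _
            · refine Measurable.lintegral_prod_right' (f := fun p :
                (Fin n → ℝ) × (Fin n → ℝ) => (S.indicator (1 : (Fin n → ℝ) → ℝ≥0∞) p.1 *
                S.indicator 1 p.2 * S.indicator 1 ((w + s z) + ε • p.1 + a 0 • p.2))) ?_
              fun_prop
        _ = youngConst ^ n * volume S ^ (k + 1 + 1) := by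
            rw [lintegral_mul_const _ hP, lintegral_prod_indicator hS]
            ring

/-- If at least two of the coefficients `aᵢ ∈ {-1, 0, 1}` are nonzero, then the relation
`w + ∑ aᵢ yᵢ ∈ S` cuts out an exponentially small part of `Sᵏ`. -/
theorem relationVolume_le (hS : MeasurableSet S) {k : ℕ} {a : Fin k → ℝ}
    (ha : ∀ i, a i = 0 ∨ |a i| = 1) (hne : ∃ i j, i ≠ j ∧ a i ≠ 0 ∧ a j ≠ 0) (w : Fin n → ℝ) :
    relationVolume S a w ≤ youngConst ^ n * volume S ^ k := by
  have hχ : Measurable (S.indicator (1 : (Fin n → ℝ) → ℝ≥0∞)) := measurable_one.indicator hS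
  induction k with
  | zero => exact Fin.elim0 hne.choose
  | succ k ih =>
    rw [relationVolume_succ hS]
    obtain ⟨i, j, hij, hi, hj⟩ := hne
    rcases ha 0 with h0 | h0
    · obtain ⟨i', rfl⟩ := Fin.exists_succ_eq.2 (show i ≠ 0 from fun h => hi (h ▸ h0))
      obtain ⟨j', rfl⟩ := Fin.exists_succ_eq.2 (show j ≠ 0 from fun h => hj (h ▸ h0))
      simp_rw [h0, zero_smul, add_zero]
      rw [lintegral_mul_const _ hχ, lintegral_indicator_one hS]
      calc _ ≤ volume S * (youngConst ^ n * volume S ^ k) := by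
            gcongr
            exact ih (fun i => ha i.succ) ⟨i', j', fun h => hij (by rw [h]), hi, hj⟩
        _ = _ := by ring
    · refine lintegral_relationVolume_le hS (fun i => ha i.succ) ?_ h0 w
      by_cases h : i = 0
      · obtain ⟨j', rfl⟩ := Fin.exists_succ_eq.2 (show j ≠ 0 from fun h' => hij (h.trans h'.symm))
        exact ⟨j', hj⟩
      · obtain ⟨i', rfl⟩ := Fin.exists_succ_eq.2 h
        exact ⟨i', hi⟩

end relationVolume

/-- The diagonal action of a matrix on tuples of vectors. -/
def tupleAct {n k : ℕ} (g : Matrix (Fin n) (Fin n) ℝ) (y : Fin k → Fin n → ℝ) :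
    Fin k → Fin n → ℝ :=
  fun i => g.mulVec (y i)

/-- The real tuple underlying a tuple of integer vectors. -/
def tupleCast {n k : ℕ} (v : Fin k → Fin n → ℤ) : Fin k → Fin n → ℝ :=
  fun i j => (v i j : ℝ)

/-- The sum of `G` over all `k`-tuples of vectors of the lattice `g ℤⁿ`. -/
def tupleSum {n k : ℕ} (G : (Fin k → Fin n → ℝ) → ℝ≥0∞) (g : SLR n) : ℝ≥0∞ :=
  ∑' v : Fin k → Fin n → ℤ, G (tupleAct g.1 (tupleCast v))

/-- The Siegel transform of `G`, as a function on the space of lattices. -/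
def latticeSum {n k : ℕ} (G : (Fin k → Fin n → ℝ) → ℝ≥0∞) (L : LatticeSpace n) : ℝ≥0∞ :=
  tupleSum G (Quotient.out (α := SLR n) L)

section latticeSum

variable {n k : ℕ}

theorem tupleAct_mul (g h : Matrix (Fin n) (Fin n) ℝ) (y : Fin k → Fin n → ℝ) :
    tupleAct (g * h) y = tupleAct g (tupleAct h y) := by
  funext i
  simp [tupleAct, Matrix.mulVec_mulVec]

theorem tupleSum_mul_map (G : (Fin k → Fin n → ℝ) → ℝ≥0∞) (g : SLR n)
    (γ : Matrix.SpecialLinearGroup (Fin n) ℤ) :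
    tupleSum G (g * Matrix.SpecialLinearGroup.map (n := Fin n) (Int.castRingHom ℝ) γ) =
      tupleSum G g := by
  let φ : (Fin k → Fin n → ℤ) ≃ (Fin k → Fin n → ℤ) :=
    { toFun := fun v i => γ.1.mulVec (v i)
      invFun := fun v i => (γ⁻¹).1.mulVec (v i)
      left_inv := fun v => by
        funext i
        dsimp only
        rw [Matrix.mulVec_mulVec, ← Matrix.SpecialLinearGroup.coe_mul]
        simp
      right_inv := fun v => by
        funext i
        dsimp only
        rw [Matrix.mulVec_mulVec, ← Matrix.SpecialLinearGroup.coe_mul]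
        simp }
  rw [tupleSum, tupleSum, ← φ.tsum_eq (fun v => G (tupleAct g.1 (tupleCast v)))]
  refine tsum_congr fun v => ?_
  rw [Matrix.SpecialLinearGroup.coe_mul, tupleAct_mul]
  congr 2
  funext i j
  simp [tupleAct, tupleCast, φ, Matrix.mulVec, dotProduct]

/-- The lattice `g ℤⁿ` as a point of the space of lattices. -/
def latticeMk (g : SLR n) : LatticeSpace n := QuotientGroup.mk (s := SLZ n) g

theorem isQuotientMap_latticeMk : Topology.IsQuotientMap (latticeMk (n := n)) :=
  QuotientGroup.isQuotientMap_mk (SLZ n)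

theorem smul_latticeMk (h g : SLR n) : h • latticeMk g = latticeMk (h * g) := rfl

theorem latticeSum_latticeMk (G : (Fin k → Fin n → ℝ) → ℝ≥0∞) (g : SLR n) :
    latticeSum G (latticeMk g) = tupleSum G g := by
  obtain ⟨γ, hγ⟩ := QuotientGroup.mk_out_eq_mul (SLZ n) g
  obtain ⟨δ, hδ⟩ := γ.2
  have h : Quotient.out (α := SLR n) (latticeMk g) = g * γ := hγ
  rw [latticeSum, h, ← hδ, tupleSum_mul_map]

theorem latticeSum_mono {G H : (Fin k → Fin n → ℝ) → ℝ≥0∞} (h : ∀ y, G y ≤ H y)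
    (L : LatticeSpace n) : latticeSum G L ≤ latticeSum H L :=
  ENNReal.tsum_le_tsum fun _ => h _

instance : ContinuousMul (SLR n) where
  continuous_mul := by
    rw [continuous_induced_rng]
    have : Continuous fun p : SLR n × SLR n => (p.1.1 * p.2.1 : Matrix (Fin n) (Fin n) ℝ) :=
      (continuous_induced_dom.comp continuous_fst).mul (continuous_induced_dom.comp continuous_snd)
    exact this

instance : ContinuousSMul (SLR n) (LatticeSpace n) :=
  inferInstanceAs (ContinuousSMul (SLR n) (SLR n ⧸ SLZ n))

instance : BorelSpace (LatticeSpace n) := ⟨rfl⟩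

theorem lowerSemicontinuous_tupleSum {G : (Fin k → Fin n → ℝ) → ℝ≥0∞}
    (hG : LowerSemicontinuous G) : LowerSemicontinuous (tupleSum (n := n) G) := by
  refine lowerSemicontinuous_tsum fun v => hG.comp ?_
  have : Continuous fun g : SLR n => (g : Matrix (Fin n) (Fin n) ℝ) := continuous_induced_dom
  unfold tupleAct
  fun_prop

theorem lowerSemicontinuous_latticeSum {G : (Fin k → Fin n → ℝ) → ℝ≥0∞}
    (hG : LowerSemicontinuous G) : LowerSemicontinuous (latticeSum (n := n) G) := by
  rw [lowerSemicontinuous_iff_isOpen_preimage]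
  intro c
  refine isQuotientMap_latticeMk.isOpen_preimage.1 ?_
  have : latticeMk ⁻¹' (latticeSum G ⁻¹' Set.Ioi c) = tupleSum (n := n) G ⁻¹' Set.Ioi c := by
    ext g
    simp only [Set.mem_preimage, latticeSum_latticeMk]
  rw [this]
  exact (lowerSemicontinuous_tupleSum hG).isOpen_preimage c

theorem measurable_latticeSum {G : (Fin k → Fin n → ℝ) → ℝ≥0∞}
    (hG : LowerSemicontinuous G) : Measurable (latticeSum (n := n) G) :=
  (lowerSemicontinuous_latticeSum hG).measurable

theorem measurable_latticeSum_smul {G : (Fin k → Fin n → ℝ) → ℝ≥0∞}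
    (hG : LowerSemicontinuous G) {α : Type*} [TopologicalSpace α] [SecondCountableTopology α]
    [MeasurableSpace α] [OpensMeasurableSpace α] {h : α → SLR n} (hh : Continuous h) :
    Measurable fun p : α × LatticeSpace n => latticeSum G (h p.1 • p.2) := by
  have hc : Continuous fun p : α × LatticeSpace n => h p.1 • p.2 := by fun_prop
  exact ((lowerSemicontinuous_latticeSum hG).comp hc).measurable

end latticeSum

section splitting

variable {n k m : ℕ}

/-- Split the columns of a `k × n` matrix into blocks of `k` and `m` columns. -/
def tupleSplit (e : Fin k ⊕ Fin m ≃ Fin n) (y : Fin k → Fin n → ℝ) :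
    (Fin k → Fin k → ℝ) × (Fin k → Fin m → ℝ) :=
  (fun i j => y i (e (.inl j)), fun i j => y i (e (.inr j)))

/-- The inverse of `tupleSplit`. -/
def tupleJoin (e : Fin k ⊕ Fin m ≃ Fin n) (p : (Fin k → Fin k → ℝ) × (Fin k → Fin m → ℝ)) :
    Fin k → Fin n → ℝ :=
  fun i l => Sum.elim (p.1 i) (p.2 i) (e.symm l)

theorem tupleSplit_tupleJoin (e : Fin k ⊕ Fin m ≃ Fin n)
    (p : (Fin k → Fin k → ℝ) × (Fin k → Fin m → ℝ)) : tupleSplit e (tupleJoin e p) = p := by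
  simp [tupleSplit, tupleJoin]

theorem tupleJoin_tupleSplit (e : Fin k ⊕ Fin m ≃ Fin n) (y : Fin k → Fin n → ℝ) :
    tupleJoin e (tupleSplit e y) = y := by
  funext i l
  obtain ⟨j, rfl⟩ := e.surjective l
  cases j <;> simp [tupleSplit, tupleJoin]

theorem continuous_tupleSplit (e : Fin k ⊕ Fin m ≃ Fin n) : Continuous (tupleSplit e) := by
  unfold tupleSplit
  fun_prop

theorem continuous_tupleJoin (e : Fin k ⊕ Fin m ≃ Fin n) : Continuous (tupleJoin e) := by
  refine continuous_pi fun i => continuous_pi fun l => ?_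
  obtain ⟨j, rfl⟩ := e.surjective l
  cases j <;> simp only [tupleJoin, Equiv.symm_apply_apply, Sum.elim_inl, Sum.elim_inr] <;> fun_prop

theorem measurePreserving_tupleSplit (e : Fin k ⊕ Fin m ≃ Fin n) :
    MeasurePreserving (tupleSplit e) := by
  have h1 : MeasurePreserving (MeasurableEquiv.piCongrLeft (fun _ : Fin n => ℝ) e).symm :=
    (volume_measurePreserving_piCongrLeft (fun _ : Fin n => ℝ) e).symm
  have h2 := h1.trans (volume_measurePreserving_sumPiEquivProdPi (fun _ : Fin k ⊕ Fin m => ℝ))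
  have h3 := volume_preserving_pi (ι := Fin k) (f := fun _ => _) (fun _ => h2)
  exact (volume_measurePreserving_arrowProdEquivProdArrow (Fin k → ℝ) (Fin m → ℝ) (Fin k)).comp h3

theorem lintegral_comp_tupleSplit (e : Fin k ⊕ Fin m ≃ Fin n)
    {f : (Fin k → Fin k → ℝ) × (Fin k → Fin m → ℝ) → ℝ≥0∞} (hf : Measurable f) :
    ∫⁻ y, f (tupleSplit e y) = ∫⁻ P, ∫⁻ Z, f (P, Z) := by
  rw [(measurePreserving_tupleSplit e).lintegral_comp hf, Measure.volume_eq_prod,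
    lintegral_prod _ hf.aemeasurable]

theorem measurePreserving_tupleAct {g : Matrix (Fin n) (Fin n) ℝ} (hg : g.det = 1) :
    MeasurePreserving (tupleAct (k := k) g) := by
  refine volume_preserving_pi (f := fun _ : Fin k => g.mulVec) fun _ => ?_
  refine ⟨by fun_prop, ?_⟩
  have := Real.map_matrix_volume_pi_eq_smul_volume_pi (M := g) (by simp [hg])
  rw [hg] at this
  simp only [inv_one, abs_one, ENNReal.ofReal_one, one_smul] at this
  exact this

theorem lintegral_floor {T : ℝ} (hT : 0 < T) (G : (Fin k → Fin n → ℤ) → ℝ≥0∞) :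
    ∫⁻ w : Fin k → Fin n → ℝ, G (fun i j => ⌊T * w i j⌋) =
      ENNReal.ofReal (T ^ (n * k))⁻¹ * ∑' v, G v := by
  have hm : Measurable fun (w : Fin k → Fin n → ℝ) i j => ⌊T * w i j⌋ := by fun_prop
  rw [← lintegral_map (f := G) (measurable_of_countable G) hm, lintegral_countable', mul_comm,
    ← ENNReal.tsum_mul_right]
  refine tsum_congr fun v => ?_
  rw [Measure.map_apply hm (measurableSet_singleton _)]
  have : (fun (w : Fin k → Fin n → ℝ) i j => ⌊T * w i j⌋) ⁻¹' {v} =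
      Set.univ.pi fun i => Set.univ.pi fun j => Set.Ico ((v i j : ℝ) / T) ((v i j + 1) / T) := by
    ext w
    simp only [Set.mem_preimage, Set.mem_singleton_iff, funext_iff, Int.floor_eq_iff,
      Set.mem_univ_pi, Set.mem_Ico, div_le_iff₀ hT, lt_div_iff₀ hT, mul_comm T]
  rw [this, volume_pi, Measure.pi_pi]
  simp_rw [volume_pi, Measure.pi_pi, Real.volume_Ico, ← sub_div, add_sub_cancel_left]
  rw [← inv_pow, ENNReal.ofReal_pow (by positivity), pow_mul]
  simp

end splitting

section siegel

variable {n k m : ℕ}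

/-- Matrix multiplication, acting on families of vectors. -/
def blockMul (A : Matrix (Fin k) (Fin k) ℝ) (Z : Fin k → Fin m → ℝ) : Fin k → Fin m → ℝ :=
  fun i j => ∑ l, A i l * Z l j

theorem blockMul_eq (A : Matrix (Fin k) (Fin k) ℝ) (Z : Fin k → Fin m → ℝ) :
    Matrix.of (blockMul A Z) = A * Matrix.of Z := by
  ext i j
  simp [blockMul, Matrix.mul_apply]

theorem blockMul_blockMul (A B : Matrix (Fin k) (Fin k) ℝ) (Z : Fin k → Fin m → ℝ) :
    blockMul A (blockMul B Z) = blockMul (A * B) Z := by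
  apply Matrix.of.injective
  rw [blockMul_eq, blockMul_eq, blockMul_eq, Matrix.mul_assoc]

theorem blockMul_one (Z : Fin k → Fin m → ℝ) : blockMul 1 Z = Z := by
  apply Matrix.of.injective
  rw [blockMul_eq, Matrix.one_mul]

/-- `blockMul` as a linear map. -/
def blockMulLin (A : Matrix (Fin k) (Fin k) ℝ) : (Fin k → Fin m → ℝ) →ₗ[ℝ] (Fin k → Fin m → ℝ) where
  toFun := blockMul A
  map_add' x y := by
    funext i j
    simp [blockMul, mul_add, Finset.sum_add_distrib]
  map_smul' c x := by
    funext i j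
    simp [blockMul, Finset.mul_sum, mul_left_comm]

theorem blockMul_add (A : Matrix (Fin k) (Fin k) ℝ) (x y : Fin k → Fin m → ℝ) :
    blockMul A (x + y) = blockMul A x + blockMul A y := (blockMulLin A).map_add x y

theorem blockMul_smul (A : Matrix (Fin k) (Fin k) ℝ) (c : ℝ) (x : Fin k → Fin m → ℝ) :
    blockMul A (c • x) = c • blockMul A x := (blockMulLin A).map_smul c x

theorem smul_blockMul (A : Matrix (Fin k) (Fin k) ℝ) (c : ℝ) (x : Fin k → Fin m → ℝ) :
    blockMul (c • A) x = c • blockMul A x := by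
  funext i j
  simp [blockMul, Finset.mul_sum, mul_assoc]

/-- The determinant of the first block of columns. -/
def blockDet (P : Fin k → Fin k → ℝ) : ℝ := (Matrix.of P).det

theorem continuous_blockDet : Continuous (blockDet (k := k)) := by
  unfold blockDet
  exact Continuous.matrix_det (by exact continuous_id)

theorem blockDet_smul (c : ℝ) (P : Fin k → Fin k → ℝ) : blockDet (c • P) = c ^ k * blockDet P := by
  rw [blockDet, blockDet, show Matrix.of (c • P) = c • Matrix.of P from rfl, Matrix.det_smul,
    Fintype.card_fin]

theorem of_smul_inv {c : ℝ} (hc : c ≠ 0) (P : Fin k → Fin k → ℝ) :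
    (Matrix.of (c⁻¹ • P))⁻¹ = c • (Matrix.of P)⁻¹ := by
  have hof : Matrix.of (c⁻¹ • P) = c⁻¹ • Matrix.of P := rfl
  by_cases hP : blockDet P = 0
  · rw [Matrix.nonsing_inv_apply_not_isUnit, Matrix.nonsing_inv_apply_not_isUnit, smul_zero]
    · exact fun h => h.ne_zero hP
    · refine fun h => h.ne_zero ?_
      have := blockDet_smul c⁻¹ P
      rw [hP, mul_zero] at this
      exact this
  · have hu : IsUnit (Matrix.of P).det := isUnit_iff_ne_zero.2 hP
    refine Matrix.inv_eq_left_inv ?_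
    rw [hof, Matrix.smul_mul, Matrix.mul_smul, smul_smul, Matrix.nonsing_inv_mul _ hu,
      mul_inv_cancel₀ hc, one_smul]

theorem exists_lintegral_blockMul_inv {P : Fin k → Fin k → ℝ} (hP : blockDet P ≠ 0) :
    ∃ c : ℝ≥0∞, ∀ f : (Fin k → Fin m → ℝ) → ℝ≥0∞, Measurable f →
      ∫⁻ Z, f (blockMul (Matrix.of P)⁻¹ Z) = c * ∫⁻ u, f u := by
  have hu : IsUnit (Matrix.of P).det := isUnit_iff_ne_zero.2 hP
  have hA : blockMulLin (m := m) (Matrix.of P)⁻¹ ∘ₗ blockMulLin (Matrix.of P) = LinearMap.id := by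
    refine LinearMap.ext fun Z => ?_
    change blockMul _ (blockMul _ Z) = Z
    rw [blockMul_blockMul, Matrix.nonsing_inv_mul _ hu, blockMul_one]
  have hdet : LinearMap.det (blockMulLin (m := m) (Matrix.of P)⁻¹) ≠ 0 := by
    intro h0
    have := congrArg LinearMap.det hA
    rw [LinearMap.det_comp, h0, zero_mul, LinearMap.det_id] at this
    exact zero_ne_one this
  have hmeas : Measurable (blockMulLin (m := m) (Matrix.of P)⁻¹) :=
    (LinearMap.continuous_of_finiteDimensional _).measurable
  refine ⟨ENNReal.ofReal |(LinearMap.det (blockMulLin (m := m) (Matrix.of P)⁻¹))⁻¹|,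
    fun f hf => ?_⟩
  change ∫⁻ Z, f (blockMulLin (Matrix.of P)⁻¹ Z) = _
  rw [← lintegral_map hf hmeas, Measure.map_linearMap_addHaar_eq_smul_addHaar _ hdet,
    lintegral_smul_measure, smul_eq_mul]

/-- The function on tuples which is `q` in the coordinates `(P, P⁻¹ Z)`, where `(P, Z)` are the
blocks of columns. -/
def siegelFun (e : Fin k ⊕ Fin m ≃ Fin n) (q : (Fin k → Fin k → ℝ) × (Fin k → Fin m → ℝ) → ℝ≥0)
    (y : Fin k → Fin n → ℝ) : ℝ≥0∞ :=
  q ((tupleSplit e y).1, blockMul (Matrix.of (tupleSplit e y).1)⁻¹ (tupleSplit e y).2)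

theorem continuousAt_blockMul_inv {p : (Fin k → Fin k → ℝ) × (Fin k → Fin m → ℝ)}
    (hp : blockDet p.1 ≠ 0) :
    ContinuousAt (fun p : (Fin k → Fin k → ℝ) × (Fin k → Fin m → ℝ) =>
      blockMul (Matrix.of p.1)⁻¹ p.2) p := by
  have h1 : ContinuousAt (fun p : (Fin k → Fin k → ℝ) × (Fin k → Fin m → ℝ) =>
      (Matrix.of p.1)⁻¹) p := by
    have h2 : ContinuousAt (fun p : (Fin k → Fin k → ℝ) × (Fin k → Fin m → ℝ) =>
      (blockDet p.1)⁻¹ • (Matrix.of p.1).adjugate) p := by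
      have i1 : ContinuousAt (fun p : (Fin k → Fin k → ℝ) × (Fin k → Fin m → ℝ) =>
          (blockDet p.1)⁻¹) p :=
        ContinuousAt.inv₀ (continuous_blockDet.comp continuous_fst).continuousAt hp
      have i2 : Continuous (fun p : (Fin k → Fin k → ℝ) × (Fin k → Fin m → ℝ) =>
          (Matrix.of p.1).adjugate) := Continuous.matrix_adjugate (by exact continuous_fst)
      exact i1.smul i2.continuousAt
    refine h2.congr (Filter.Eventually.of_forall fun p => ?_)
    simp only [Matrix.inv_def, Ring.inverse_eq_inv', blockDet]
  unfold blockMul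
  refine continuousAt_pi.2 fun i => continuousAt_pi.2 fun j => ?_
  refine tendsto_finsetSum _ fun l _ => ?_
  exact ContinuousAt.mul ((continuousAt_pi.1 (continuousAt_pi.1 h1 i)) l)
    (by fun_prop)

theorem lowerSemicontinuous_siegelFun (e : Fin k ⊕ Fin m ≃ Fin n)
    {q : (Fin k → Fin k → ℝ) × (Fin k → Fin m → ℝ) → ℝ≥0} (hq : Continuous q)
    (hsupp : ∀ p, q p ≠ 0 → blockDet p.1 ≠ 0) : LowerSemicontinuous (siegelFun e q) := by
  intro y
  by_cases hy : blockDet (tupleSplit e y).1 = 0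
  · intro c hc
    have : siegelFun e q y = 0 := by
      by_contra h
      exact hsupp ((tupleSplit e y).1, blockMul (Matrix.of (tupleSplit e y).1)⁻¹ (tupleSplit e y).2)
        (fun h0 => h (by rw [siegelFun, h0, ENNReal.coe_zero])) hy
    rw [this] at hc
    exact absurd hc not_lt_zero
  · refine ContinuousAt.lowerSemicontinuousAt ?_
    have h1 := (continuousAt_blockMul_inv hy).comp (continuous_tupleSplit e).continuousAt
    have h2 := (continuous_fst.comp (continuous_tupleSplit e)).continuousAt (x := y)
    exact ENNReal.continuous_coe.continuousAt.comp (hq.continuousAt.comp (h2.prodMk h1))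

/-- The unimodular matrices used for averaging: a unipotent block `s` together with a
diagonal scaling by powers of `t`. -/
def shear (e : Fin k ⊕ Fin m ≃ Fin n) {t : ℝ} (ht : t ≠ 0) (s : Fin k → Fin m → ℝ) : SLR n :=
  ⟨Matrix.reindex e e (Matrix.fromBlocks ((t ^ m)⁻¹ • 1) 0 (t ^ k • (Matrix.of s).transpose)
    (t ^ k • 1)), by
    rw [Matrix.det_reindex_self, Matrix.det_fromBlocks_zero₁₂, Matrix.det_smul, Matrix.det_smul]
    simp only [Fintype.card_fin, Matrix.det_one, mul_one, inv_pow, ← pow_mul]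
    rw [mul_comm m k, inv_mul_cancel₀ (pow_ne_zero _ ht)]⟩

theorem continuous_shear (e : Fin k ⊕ Fin m ≃ Fin n) {t : ℝ} (ht : t ≠ 0) :
    Continuous (shear e ht) := by
  rw [continuous_induced_rng]
  refine Continuous.matrix_reindex ?_ e e
  refine Continuous.matrix_fromBlocks continuous_const continuous_const ?_ continuous_const
  have : Continuous fun s : Fin k → Fin m → ℝ => (Matrix.of s).transpose :=
    Continuous.matrix_transpose (by exact continuous_id)
  exact this.const_smul (t ^ k)

theorem tupleSplit_tupleAct_shear (e : Fin k ⊕ Fin m ≃ Fin n) {t : ℝ} (ht : t ≠ 0)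
    (s : Fin k → Fin m → ℝ) (y : Fin k → Fin n → ℝ) :
    tupleSplit e (tupleAct (shear e ht s).1 y) = ((t ^ m)⁻¹ • (tupleSplit e y).1,
      t ^ k • ((tupleSplit e y).2 + blockMul (Matrix.of (tupleSplit e y).1) s)) := by
  have hsum : ∀ f : Fin n → ℝ, ∑ l, f l = ∑ l, f (e (.inl l)) + ∑ l, f (e (.inr l)) := fun f => by
    rw [← e.sum_comp f, Fintype.sum_sum_type]
  refine Prod.ext ?_ ?_
  · funext i j
    simp [tupleSplit, tupleAct, shear, Matrix.mulVec, dotProduct, hsum, Matrix.one_apply]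
  · funext i j
    simp [tupleSplit, tupleAct, shear, Matrix.mulVec, dotProduct, hsum, Matrix.one_apply, blockMul,
      Finset.mul_sum, mul_add, mul_assoc, mul_comm, mul_left_comm, add_comm]

theorem siegelFun_shear (e : Fin k ⊕ Fin m ≃ Fin n)
    {q : (Fin k → Fin k → ℝ) × (Fin k → Fin m → ℝ) → ℝ≥0}
    (hsupp : ∀ p, q p ≠ 0 → blockDet p.1 ≠ 0) {t : ℝ} (ht : t ≠ 0)
    (s : Fin k → Fin m → ℝ) (y : Fin k → Fin n → ℝ) :
    siegelFun e q (tupleAct (shear e ht s).1 y) =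
      q ((t ^ m)⁻¹ • (tupleSplit e y).1, (t ^ (k + m)) •
        (s + blockMul (Matrix.of (tupleSplit e y).1)⁻¹ (tupleSplit e y).2)) := by
  rw [siegelFun, tupleSplit_tupleAct_shear]
  set P := (tupleSplit e y).1
  set Z := (tupleSplit e y).2
  by_cases hP : blockDet P = 0
  · have hz : ∀ u, q ((t ^ m)⁻¹ • P, u) = 0 := fun u => by
      by_contra h
      exact hsupp _ h (by rw [blockDet_smul, hP, mul_zero])
    rw [hz, hz]
  · have hu : IsUnit (Matrix.of P).det := isUnit_iff_ne_zero.2 hP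
    dsimp only
    rw [of_smul_inv (pow_ne_zero _ ht), smul_blockMul, blockMul_smul, smul_smul, blockMul_add,
      blockMul_blockMul, Matrix.nonsing_inv_mul _ hu, blockMul_one, add_comm s, pow_add,
      mul_comm (t ^ m)]

/-- The integrand of the averaged Siegel transform. -/
def siegelKernel (e : Fin k ⊕ Fin m ≃ Fin n)
    (q : (Fin k → Fin k → ℝ) × (Fin k → Fin m → ℝ) → ℝ≥0) (φ : (Fin k → Fin m → ℝ) → ℝ≥0)
    (p : ℝ × (Fin k → Fin n → ℝ) × (Fin k → Fin m → ℝ)) : ℝ≥0 :=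
  φ (p.1 • p.2.2 - blockMul (Matrix.of (tupleSplit e p.2.1).1)⁻¹ (tupleSplit e p.2.1).2) *
    q ((tupleSplit e p.2.1).1, p.2.2)

theorem lintegral_comp_smul {c : ℝ} (hc : 0 < c) {f : (Fin k → Fin m → ℝ) → ℝ≥0∞}
    (hf : Measurable f) :
    ∫⁻ s, f (c • s) = ENNReal.ofReal (c ^ (m * k))⁻¹ * ∫⁻ u, f u := by
  have hm : Measurable fun s : Fin k → Fin m → ℝ => c • s := by fun_prop
  rw [← lintegral_map hf hm, Measure.map_addHaar_smul _ hc.ne', lintegral_smul_measure,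
    smul_eq_mul, abs_of_pos (by positivity)]
  simp [Module.finrank_pi_fintype, mul_comm]

theorem lintegral_siegelFun_shear (e : Fin k ⊕ Fin m ≃ Fin n)
    {q : (Fin k → Fin k → ℝ) × (Fin k → Fin m → ℝ) → ℝ≥0} (hq : Continuous q)
    (hsupp : ∀ p, q p ≠ 0 → blockDet p.1 ≠ 0) {φ : (Fin k → Fin m → ℝ) → ℝ≥0}
    (hφ : Continuous φ) {t : ℝ} (ht : 0 < t) (y : Fin k → Fin n → ℝ) :
    ∫⁻ s, φ s * siegelFun e q (tupleAct (shear e ht.ne' s).1 y) =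
      ENNReal.ofReal ((t ^ (k + m)) ^ (m * k))⁻¹ *
        ∫⁻ u, siegelKernel e q φ ((t ^ (k + m))⁻¹, (t ^ m)⁻¹ • y, u) := by
  simp_rw [siegelFun_shear e hsupp]
  have hsplit : tupleSplit e ((t ^ m)⁻¹ • y) =
    ((t ^ m)⁻¹ • (tupleSplit e y).1, (t ^ m)⁻¹ • (tupleSplit e y).2) := rfl
  set P := (tupleSplit e y).1
  set Z := (tupleSplit e y).2
  have htm : t ^ m ≠ 0 := by positivity
  have hPZ : blockMul (Matrix.of ((t ^ m)⁻¹ • P))⁻¹ ((t ^ m)⁻¹ • Z) =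
      blockMul (Matrix.of P)⁻¹ Z := by
    rw [of_smul_inv htm, smul_blockMul, blockMul_smul, smul_smul, mul_inv_cancel₀ htm, one_smul]
  rw [← lintegral_sub_right_eq_self _ (blockMul (Matrix.of P)⁻¹ Z)]
  simp only [sub_add_cancel, siegelKernel, hsplit, hPZ]
  have hpos : 0 < t ^ (k + m) := by positivity
  rw [← lintegral_comp_smul hpos]
  · simp_rw [smul_smul, inv_mul_cancel₀ hpos.ne', one_smul, ENNReal.coe_mul]
  · fun_prop

end siegel

section siegelLimit

open Filter Topology

variable {n k m : ℕ} {e : Fin k ⊕ Fin m ≃ Fin n}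
  {q : (Fin k → Fin k → ℝ) × (Fin k → Fin m → ℝ) → ℝ≥0} {φ : (Fin k → Fin m → ℝ) → ℝ≥0}

theorem blockDet_ne_zero_of_ne_zero (hqs : tsupport q ⊆ {p | blockDet p.1 ≠ 0})
    (p : (Fin k → Fin k → ℝ) × (Fin k → Fin m → ℝ)) (hp : q p ≠ 0) : blockDet p.1 ≠ 0 :=
  hqs (subset_tsupport q hp)

theorem continuous_siegelKernel (hq : Continuous q) (hqs : tsupport q ⊆ {p | blockDet p.1 ≠ 0})
    (hφ : Continuous φ) : Continuous (siegelKernel e q φ) := by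
  refine continuous_iff_continuousAt.2 fun p => ?_
  have hs : Continuous fun p : ℝ × (Fin k → Fin n → ℝ) × (Fin k → Fin m → ℝ) =>
      tupleSplit e p.2.1 := (continuous_tupleSplit e).comp (by fun_prop)
  have hr : Continuous fun p : ℝ × (Fin k → Fin n → ℝ) × (Fin k → Fin m → ℝ) =>
      ((tupleSplit e p.2.1).1, p.2.2) := (continuous_fst.comp hs).prodMk (by fun_prop)
  by_cases hp : ((tupleSplit e p.2.1).1, p.2.2) ∈ tsupport q
  · have h1 := (continuousAt_blockMul_inv (p := tupleSplit e p.2.1)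
      (show _ from hqs hp : blockDet ((tupleSplit e p.2.1).1, p.2.2).1 ≠ 0)).comp
      (f := fun p : ℝ × (Fin k → Fin n → ℝ) × (Fin k → Fin m → ℝ) => tupleSplit e p.2.1)
      (x := p) hs.continuousAt
    have h2 : Continuous fun p : ℝ × (Fin k → Fin n → ℝ) × (Fin k → Fin m → ℝ) =>
      p.1 • p.2.2 := by fun_prop
    exact (hφ.continuousAt.comp (h2.continuousAt.sub h1)).mul (hq.comp hr).continuousAt
  · have h0 : q =ᶠ[𝓝 ((tupleSplit e p.2.1).1, p.2.2)] 0 := notMem_tsupport_iff_eventuallyEq.1 hp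
    have h1 : siegelKernel e q φ =ᶠ[𝓝 p] fun _ => 0 := by
      filter_upwards [hr.continuousAt.eventually h0] with p' hp'
      rw [siegelKernel, hp', Pi.zero_apply, mul_zero]
    exact continuousAt_const.congr h1.symm

theorem exists_siegelKernel_bound (hq : Continuous q) (hqc : HasCompactSupport q)
    (hqs : tsupport q ⊆ {p | blockDet p.1 ≠ 0}) (hφ : Continuous φ) (hφc : HasCompactSupport φ) :
    ∃ (M : ℝ≥0) (R : ℝ), ∀ r ∈ Set.Icc (0 : ℝ) 1, ∀ y u, siegelKernel e q φ (r, y, u) ≤ M ∧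
      (siegelKernel e q φ (r, y, u) ≠ 0 → ‖y‖ ≤ R ∧ ‖u‖ ≤ R) := by
  obtain ⟨M₁, hM₁⟩ := (hφc.isCompact_range hφ).bddAbove
  obtain ⟨M₂, hM₂⟩ := (hqc.isCompact_range hq).bddAbove
  let Φ : ℝ × ((Fin k → Fin k → ℝ) × (Fin k → Fin m → ℝ)) × (Fin k → Fin m → ℝ) →
      (Fin k → Fin n → ℝ) × (Fin k → Fin m → ℝ) := fun x =>
    (tupleJoin e (x.2.1.1, blockMul (Matrix.of x.2.1.1) (x.1 • x.2.1.2 - x.2.2)), x.2.1.2)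
  have hΦ : Continuous Φ := by
    refine ((continuous_tupleJoin e).comp ?_).prodMk (by fun_prop)
    refine Continuous.prodMk (by fun_prop) ?_
    unfold blockMul
    simp only [Matrix.of_apply]
    fun_prop
  have hK : IsCompact (Φ '' (Set.Icc (0 : ℝ) 1 ×ˢ tsupport q ×ˢ tsupport φ)) :=
    (isCompact_Icc.prod (IsCompact.prod hqc hφc)).image hΦ
  obtain ⟨R, hR⟩ := hK.isBounded.exists_norm_le
  refine ⟨M₁ * M₂, R, fun r hr y u => ⟨?_, fun h => ?_⟩⟩
  · exact mul_le_mul' (hM₁ ⟨_, rfl⟩) (hM₂ ⟨_, rfl⟩)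
  · obtain ⟨h1, h2⟩ := mul_ne_zero_iff.1 h
    dsimp only at h1 h2
    have hP : IsUnit (Matrix.of (tupleSplit e y).1).det :=
      isUnit_iff_ne_zero.2 (blockDet_ne_zero_of_ne_zero hqs ((tupleSplit e y).1, u) h2)
    have hmem : (y, u) ∈ Φ '' (Set.Icc (0 : ℝ) 1 ×ˢ tsupport q ×ˢ tsupport φ) := by
      refine ⟨(r, ((tupleSplit e y).1, u), r • u -
        blockMul (Matrix.of (tupleSplit e y).1)⁻¹ (tupleSplit e y).2),
        ⟨hr, subset_tsupport q h2, subset_tsupport φ h1⟩, ?_⟩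
      simp only [Φ, sub_sub_cancel, blockMul_blockMul, Matrix.mul_nonsing_inv _ hP, blockMul_one,
        Prod.mk.eta, tupleJoin_tupleSplit]
    have := hR _ hmem
    exact ⟨(norm_fst_le (y, u)).trans this, (norm_snd_le (y, u)).trans this⟩

theorem lintegral_siegelKernel_zero (hq : Continuous q)
    (hqs : tsupport q ⊆ {p | blockDet p.1 ≠ 0}) (hφ : Continuous φ) :
    ∫⁻ y, ∫⁻ u, (siegelKernel e q φ (0, y, u) : ℝ≥0∞) =
      (∫⁻ s, φ s) * ∫⁻ y, siegelFun e q y := by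
  have hsupp := blockDet_ne_zero_of_ne_zero hqs
  have hF : Measurable fun p : (Fin k → Fin k → ℝ) × (Fin k → Fin m → ℝ) =>
      (q (p.1, blockMul (Matrix.of p.1)⁻¹ p.2) : ℝ≥0∞) := by
    have := ((lowerSemicontinuous_siegelFun e hq hsupp).comp (continuous_tupleJoin e)).measurable
    simpa only [Function.comp_def, siegelFun, tupleSplit_tupleJoin] using this
  have hK : Measurable fun p : (Fin k → Fin k → ℝ) × (Fin k → Fin m → ℝ) =>
      ∫⁻ u, (φ ((0 : ℝ) • u - blockMul (Matrix.of p.1)⁻¹ p.2) * q (p.1, u) : ℝ≥0∞) := by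
    have h1 : Measurable fun p : ((Fin k → Fin k → ℝ) × (Fin k → Fin m → ℝ)) ×
        (Fin k → Fin m → ℝ) => (siegelKernel e q φ (0, tupleJoin e p.1, p.2) : ℝ≥0∞) := by
      have := continuous_siegelKernel (e := e) hq hqs hφ
      have h2 := continuous_tupleJoin e
      exact (ENNReal.continuous_coe.comp (this.comp (by fun_prop))).measurable
    simpa only [siegelKernel, tupleSplit_tupleJoin, ENNReal.coe_mul] using h1.lintegral_prod_right'
  calc ∫⁻ y, ∫⁻ u, (siegelKernel e q φ (0, y, u) : ℝ≥0∞)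
      = ∫⁻ P, ∫⁻ Z, ∫⁻ u, (φ ((0 : ℝ) • u - blockMul (Matrix.of P)⁻¹ Z) * q (P, u) : ℝ≥0∞) := by
        rw [← lintegral_comp_tupleSplit e hK]
        simp only [siegelKernel, ENNReal.coe_mul]
    _ = ∫⁻ P, (∫⁻ s, φ s) * ∫⁻ Z, q (P, blockMul (Matrix.of P)⁻¹ Z) := by
        refine lintegral_congr fun P => ?_
        by_cases hP : blockDet P = 0
        · have h0 : ∀ u, q (P, u) = 0 := fun u => by
            by_contra h
            exact hsupp _ h hP
          simp [h0]
        · obtain ⟨c, hc⟩ := exists_lintegral_blockMul_inv (m := m) hP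
          have hqP : Measurable fun u => (q (P, u) : ℝ≥0∞) := by fun_prop
          rw [hc (fun u => q (P, u)) hqP]
          have h1 : ∀ Z, ∫⁻ u, (φ ((0 : ℝ) • u - blockMul (Matrix.of P)⁻¹ Z) * q (P, u) : ℝ≥0∞) =
              φ (- blockMul (Matrix.of P)⁻¹ Z) * ∫⁻ u, q (P, u) := fun Z => by
            simp only [zero_smul, zero_sub]
            rw [lintegral_const_mul _ hqP]
          simp_rw [h1]
          have hφm : Measurable fun Z => (φ (-Z) : ℝ≥0∞) := by fun_prop
          have hb : Measurable (blockMul (m := m) (Matrix.of P)⁻¹) :=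
            (LinearMap.continuous_of_finiteDimensional (blockMulLin (Matrix.of P)⁻¹)).measurable
          have hφb : Measurable fun Z => (φ (-blockMul (Matrix.of P)⁻¹ Z) : ℝ≥0∞) := hφm.comp hb
          rw [lintegral_mul_const _ hφb, hc _ hφm,
            lintegral_neg_eq_self (fun Z => (φ Z : ℝ≥0∞))]
          ring
    _ = _ := by
        rw [lintegral_const_mul _ hF.lintegral_prod_right']
        congr 1
        exact (lintegral_comp_tupleSplit e hF).symm

end siegelLimit

section siegelAverage

open Filter Topology

variable {n k m : ℕ} {e : Fin k ⊕ Fin m ≃ Fin n}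
  {q : (Fin k → Fin k → ℝ) × (Fin k → Fin m → ℝ) → ℝ≥0} {φ : (Fin k → Fin m → ℝ) → ℝ≥0}

theorem continuous_tupleAct (g : Matrix (Fin n) (Fin n) ℝ) : Continuous (tupleAct (k := k) g) := by
  unfold tupleAct
  fun_prop

theorem tupleAct_smul (g : Matrix (Fin n) (Fin n) ℝ) (c : ℝ) (y : Fin k → Fin n → ℝ) :
    tupleAct g (c • y) = c • tupleAct g y := by
  funext i
  simp [tupleAct, Matrix.mulVec_smul]

/-- The point of the grid of mesh `T⁻¹` obtained by rounding down. -/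
def gridFloor (T : ℝ) (w : Fin k → Fin n → ℝ) : Fin k → Fin n → ℝ :=
  T⁻¹ • tupleCast fun i j => ⌊T * w i j⌋

theorem measurable_gridFloor (T : ℝ) : Measurable (gridFloor (n := n) (k := k) T) := by
  unfold gridFloor tupleCast
  fun_prop

theorem norm_gridFloor_sub_le {T : ℝ} (hT : 0 < T) (w : Fin k → Fin n → ℝ) :
    ‖gridFloor T w - w‖ ≤ T⁻¹ := by
  refine (pi_norm_le_iff_of_nonneg (by positivity)).2 fun i =>
    (pi_norm_le_iff_of_nonneg (by positivity)).2 fun j => ?_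
  simp only [gridFloor, tupleCast, Pi.sub_apply, Pi.smul_apply, smul_eq_mul, Real.norm_eq_abs]
  have h1 := Int.floor_le (T * w i j)
  have h2 := Int.lt_floor_add_one (T * w i j)
  have h3 : T⁻¹ * (⌊T * w i j⌋ : ℝ) - w i j = T⁻¹ * (⌊T * w i j⌋ - T * w i j) := by
    field_simp
  rw [h3, abs_mul, abs_of_pos (inv_pos.2 hT)]
  refine mul_le_of_le_one_right (by positivity) (abs_le.2 ⟨by linarith, by linarith⟩)

theorem lintegral_tupleSum_shear (hq : Continuous q)
    (hqs : tsupport q ⊆ {p | blockDet p.1 ≠ 0}) (hφ : Continuous φ) {t : ℝ} (ht : 0 < t)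
    (g : SLR n) :
    ∫⁻ s, φ s * tupleSum (siegelFun e q) (shear e ht.ne' s * g) =
      ∫⁻ w, ∫⁻ u, (siegelKernel e q φ
        ((t ^ (k + m))⁻¹, tupleAct g.1 (gridFloor (t ^ m) w), u) : ℝ≥0∞) := by
  have hsupp := blockDet_ne_zero_of_ne_zero hqs
  have hkm : k + m = n := by simpa using Fintype.card_congr e
  have hmeas : ∀ y : Fin k → Fin n → ℝ,
      Measurable fun s => (φ s * siegelFun e q (tupleAct (shear e ht.ne' s).1 y) : ℝ≥0∞) := by
    intro y
    refine Measurable.mul (f := fun s => (φ s : ℝ≥0∞)) (by fun_prop) ?_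
    refine ((lowerSemicontinuous_siegelFun e hq hsupp).comp ?_).measurable
    have : Continuous fun s => (shear e ht.ne' s).1 :=
      continuous_induced_dom.comp (continuous_shear e ht.ne')
    unfold tupleAct
    fun_prop
  have h1 : ∀ s, (φ s : ℝ≥0∞) * tupleSum (siegelFun e q) (shear e ht.ne' s * g) =
      ∑' v : Fin k → Fin n → ℤ,
        (φ s * siegelFun e q (tupleAct (shear e ht.ne' s).1 (tupleAct g.1 (tupleCast v)))) := by
    intro s
    rw [tupleSum, ← ENNReal.tsum_mul_left]
    simp only [Matrix.SpecialLinearGroup.coe_mul, tupleAct_mul]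
  simp_rw [h1]
  rw [lintegral_tsum fun v => (hmeas _).aemeasurable]
  simp_rw [lintegral_siegelFun_shear e hq hsupp hφ ht]
  rw [ENNReal.tsum_mul_left, show (t ^ (k + m)) ^ (m * k) = (t ^ m) ^ (n * k) by
    rw [hkm, ← pow_mul, ← pow_mul]; congr 1; ring]
  rw [← lintegral_floor (pow_pos ht m) fun v : Fin k → Fin n → ℤ =>
    ∫⁻ u, (siegelKernel e q φ ((t ^ (k + m))⁻¹, (t ^ m)⁻¹ • tupleAct g.1 (tupleCast v), u) : ℝ≥0∞)]
  simp only [gridFloor, tupleAct_smul]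

theorem exists_norm_le_of_gridFloor (g : SLR n) (R : ℝ) :
    ∃ R' : ℝ, ∀ (T : ℝ) (w : Fin k → Fin n → ℝ), 1 ≤ T → ‖tupleAct g.1 (gridFloor T w)‖ ≤ R →
      ‖w‖ ≤ R' := by
  have hgu : IsUnit g.1.det := by simp
  obtain ⟨R', hR'⟩ := ((isCompact_closedBall (0 : Fin k → Fin n → ℝ) R).image
    (continuous_tupleAct (g.1)⁻¹)).isBounded.exists_norm_le
  refine ⟨R' + 1, fun T w hT h => ?_⟩
  have h1 := hR' _ (Set.mem_image_of_mem _ (mem_closedBall_zero_iff.2 h))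
  have h2 : tupleAct (1 : Matrix (Fin n) (Fin n) ℝ) (gridFloor T w) = gridFloor T w := by
    funext i
    simp [tupleAct]
  rw [← tupleAct_mul, Matrix.nonsing_inv_mul _ hgu, h2] at h1
  have h3 := norm_gridFloor_sub_le (by positivity : 0 < T) w
  have h4 : T⁻¹ ≤ 1 := inv_le_one_of_one_le₀ hT
  have h5 := norm_le_norm_add_norm_sub (gridFloor T w) w
  linarith

theorem continuous_siegelKernel_tupleAct (hq : Continuous q)
    (hqs : tsupport q ⊆ {p | blockDet p.1 ≠ 0}) (hφ : Continuous φ)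
    (g : Matrix (Fin n) (Fin n) ℝ) :
    Continuous fun p : ℝ × (Fin k → Fin n → ℝ) × (Fin k → Fin m → ℝ) =>
      (siegelKernel e q φ (p.1, tupleAct g p.2.1, p.2.2) : ℝ≥0∞) := by
  have := continuous_tupleAct (k := k) g
  exact ENNReal.continuous_coe.comp
    ((continuous_siegelKernel (e := e) hq hqs hφ).comp (by fun_prop))

theorem measurable_siegelKernel_gridFloor (hq : Continuous q)
    (hqs : tsupport q ⊆ {p | blockDet p.1 ≠ 0}) (hφ : Continuous φ)
    (g : Matrix (Fin n) (Fin n) ℝ) (r T : ℝ) :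
    Measurable fun p : (Fin k → Fin n → ℝ) × (Fin k → Fin m → ℝ) =>
      (siegelKernel e q φ (r, tupleAct g (gridFloor T p.1), p.2) : ℝ≥0∞) := by
  have h1 := measurable_gridFloor (n := n) (k := k) T
  have h2 : Measurable fun p : (Fin k → Fin n → ℝ) × (Fin k → Fin m → ℝ) =>
    (r, gridFloor T p.1, p.2) := by fun_prop
  exact (continuous_siegelKernel_tupleAct hq hqs hφ g).measurable.comp h2

theorem lintegral_siegelKernel_zero_tupleAct (hq : Continuous q)
    (hqs : tsupport q ⊆ {p | blockDet p.1 ≠ 0}) (hφ : Continuous φ)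
    {g : Matrix (Fin n) (Fin n) ℝ} (hg : g.det = 1) :
    ∫⁻ p : (Fin k → Fin n → ℝ) × (Fin k → Fin m → ℝ),
        (siegelKernel e q φ (0, tupleAct g p.1, p.2) : ℝ≥0∞) =
      (∫⁻ s, φ s) * ∫⁻ y, siegelFun e q y := by
  have hc : Continuous fun p : (Fin k → Fin n → ℝ) × (Fin k → Fin m → ℝ) => ((0 : ℝ), p) := by
    fun_prop
  have h1 : Measurable fun p : (Fin k → Fin n → ℝ) × (Fin k → Fin m → ℝ) =>
      (siegelKernel e q φ (0, tupleAct g p.1, p.2) : ℝ≥0∞) :=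
    ((continuous_siegelKernel_tupleAct hq hqs hφ g).comp hc).measurable
  have h2 : Measurable fun p : (Fin k → Fin n → ℝ) × (Fin k → Fin m → ℝ) =>
      (siegelKernel e q φ (0, p.1, p.2) : ℝ≥0∞) :=
    (ENNReal.continuous_coe.comp ((continuous_siegelKernel hq hqs hφ).comp hc)).measurable
  rw [Measure.volume_eq_prod, lintegral_prod _ h1.aemeasurable,
    ← lintegral_siegelKernel_zero hq hqs hφ,
    ← (measurePreserving_tupleAct hg).lintegral_comp h2.lintegral_prod_right']

theorem tendsto_lintegral_tupleSum_shear (hm : 1 ≤ m) (hq : Continuous q)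
    (hqc : HasCompactSupport q)
    (hqs : tsupport q ⊆ {p | blockDet p.1 ≠ 0}) (hφ : Continuous φ) (hφc : HasCompactSupport φ)
    (g : SLR n) :
    Tendsto (fun j : ℕ => ∫⁻ s, φ s *
        tupleSum (siegelFun e q) (shear e (Nat.cast_add_one_ne_zero (R := ℝ) j) s * g)) atTop
      (𝓝 ((∫⁻ s, φ s) * ∫⁻ y, siegelFun e q y)) := by
  obtain ⟨M, R, hMR⟩ := exists_siegelKernel_bound (e := e) hq hqc hqs hφ hφc
  obtain ⟨R', hR'⟩ := exists_norm_le_of_gridFloor (k := k) g R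
  have hone : ∀ (j : ℕ) (l : ℕ), 1 ≤ ((j : ℝ) + 1) ^ l := fun j l =>
    one_le_pow₀ (by linarith [(Nat.cast_nonneg j : (0 : ℝ) ≤ j)])
  have hpos : ∀ (j : ℕ) (l : ℕ), 0 < ((j : ℝ) + 1) ^ l := fun j l => by positivity
  have htop : ∀ l, 1 ≤ l → Tendsto (fun j : ℕ => (((j : ℝ) + 1) ^ l)⁻¹) atTop (𝓝 0) := fun l hl =>
    tendsto_inv_atTop_zero.comp ((tendsto_pow_atTop (by omega)).comp
      (tendsto_atTop_add_const_right _ _ tendsto_natCast_atTop_atTop))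
  have hmeas := fun j : ℕ => measurable_siegelKernel_gridFloor (e := e) hq hqs hφ g.1
    (((j : ℝ) + 1) ^ (k + m))⁻¹ (((j : ℝ) + 1) ^ m)
  have hA : ∀ j : ℕ, ∫⁻ s, φ s *
        tupleSum (siegelFun e q) (shear e (Nat.cast_add_one_ne_zero (R := ℝ) j) s * g) =
      ∫⁻ p : (Fin k → Fin n → ℝ) × (Fin k → Fin m → ℝ),
        (siegelKernel e q φ ((((j : ℝ) + 1) ^ (k + m))⁻¹,
        tupleAct g.1 (gridFloor (((j : ℝ) + 1) ^ m) p.1), p.2) : ℝ≥0∞) := fun j => by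
    have h0 : (0 : ℝ) < (j : ℝ) + 1 := by positivity
    rw [lintegral_tupleSum_shear hq hqs hφ h0, Measure.volume_eq_prod,
      lintegral_prod _ (hmeas j).aemeasurable]
  rw [← lintegral_siegelKernel_zero_tupleAct hq hqs hφ g.2, funext hA]
  refine tendsto_lintegral_of_dominated_convergence
    ((Metric.closedBall 0 (max R' R)).indicator fun _ => (M : ℝ≥0∞)) hmeas
    (fun j => Eventually.of_forall fun p => ?_) ?_ (Eventually.of_forall fun p => ?_)
  · have hmem : (((j : ℝ) + 1) ^ (k + m))⁻¹ ∈ Set.Icc (0 : ℝ) 1 :=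
      ⟨(inv_pos.2 (hpos j _)).le, inv_le_one_of_one_le₀ (hone j _)⟩
    obtain ⟨h1, h2⟩ := hMR _ hmem (tupleAct g.1 (gridFloor (((j : ℝ) + 1) ^ m) p.1)) p.2
    by_cases h0 : siegelKernel e q φ ((((j : ℝ) + 1) ^ (k + m))⁻¹,
        tupleAct g.1 (gridFloor (((j : ℝ) + 1) ^ m) p.1), p.2) = 0
    · exact (ENNReal.coe_eq_zero.2 h0).trans_le zero_le
    · obtain ⟨h3, h4⟩ := h2 h0
      rw [Set.indicator_of_mem]
      · exact ENNReal.coe_le_coe.2 h1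
      · rw [mem_closedBall_zero_iff, Prod.norm_def]
        exact max_le_max (hR' _ _ (hone j m) h3) h4
  · rw [lintegral_indicator_const Metric.isClosed_closedBall.measurableSet]
    exact ENNReal.mul_ne_top ENNReal.coe_ne_top measure_closedBall_lt_top.ne
  · have hcont := continuous_siegelKernel_tupleAct (e := e) hq hqs hφ g.1
    have h1 : Tendsto (fun j : ℕ => gridFloor (((j : ℝ) + 1) ^ m) p.1) atTop (𝓝 p.1) := by
      rw [tendsto_iff_norm_sub_tendsto_zero]
      exact squeeze_zero (fun _ => norm_nonneg _)
        (fun j => norm_gridFloor_sub_le (hpos j m) p.1) (htop m hm)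
    have h2 := (htop (k + m) (by omega)).prodMk_nhds
      (h1.prodMk_nhds (tendsto_const_nhds (x := p.2)))
    exact (hcont.tendsto _).comp h2

end siegelAverage

section siegelExpectation

open Filter Topology

variable {n k m : ℕ} {e : Fin k ⊕ Fin m ≃ Fin n}
  {q : (Fin k → Fin k → ℝ) × (Fin k → Fin m → ℝ) → ℝ≥0}
  {μ : Measure (LatticeSpace n)}

theorem exists_continuous_hasCompactSupport_lintegral_eq_one :
    ∃ φ : (Fin k → Fin m → ℝ) → ℝ≥0, Continuous φ ∧ HasCompactSupport φ ∧
      ∫⁻ s, (φ s : ℝ≥0∞) = 1 := by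
  let f : ContDiffBump (0 : Fin k → Fin m → ℝ) := ⟨1, 2, one_pos, one_lt_two⟩
  refine ⟨fun s => (f.normed volume s).toNNReal, ?_, ?_, ?_⟩
  · exact continuous_real_toNNReal.comp f.continuous_normed
  · exact f.hasCompactSupport_normed.comp_left (g := Real.toNNReal) Real.toNNReal_zero
  · have := ofReal_integral_eq_lintegral_ofReal (f.integrable_normed (μ := volume))
      (Eventually.of_forall fun s => f.nonneg_normed s)
    rw [f.integral_normed, ENNReal.ofReal_one] at this
    exact this.symm

theorem lintegral_latticeSum_siegelFun_le [IsProbabilityMeasure μ]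
    (hμ : ∀ g : SLR n, Measure.map (fun x => g • x) μ = μ) (hm : 1 ≤ m) (hq : Continuous q)
    (hqc : HasCompactSupport q) (hqs : tsupport q ⊆ {p | blockDet p.1 ≠ 0}) :
    ∫⁻ L, latticeSum (siegelFun e q) L ∂μ ≤ ∫⁻ y, siegelFun e q y := by
  obtain ⟨φ, hφ, hφc, hφ1⟩ := exists_continuous_hasCompactSupport_lintegral_eq_one (k := k) (m := m)
  have hlsc := lowerSemicontinuous_siegelFun e hq (blockDet_ne_zero_of_ne_zero hqs)
  have hF : Measurable (latticeSum (n := n) (siegelFun e q)) := measurable_latticeSum hlsc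
  have hφm : Measurable fun s => (φ s : ℝ≥0∞) := by fun_prop
  set h : ℕ → (Fin k → Fin m → ℝ) → SLR n :=
    fun j => shear e (Nat.cast_add_one_ne_zero (R := ℝ) j) with hh
  have hjoint : ∀ j, Measurable fun p : (Fin k → Fin m → ℝ) × LatticeSpace n =>
      latticeSum (siegelFun e q) (h j p.1 • p.2) := fun j =>
    measurable_latticeSum_smul hlsc (continuous_shear e _)
  have hlim : ∀ L, Tendsto (fun j => ∫⁻ s, φ s * latticeSum (siegelFun e q) (h j s • L)) atTop
      (𝓝 (∫⁻ y, siegelFun e q y)) := by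
    intro L
    obtain ⟨g, rfl⟩ := isQuotientMap_latticeMk.surjective L
    have := tendsto_lintegral_tupleSum_shear hm hq hqc hqs hφ hφc g (e := e)
    rw [hφ1, one_mul] at this
    simpa only [hh, smul_latticeMk, latticeSum_latticeMk] using this
  have hmin : ∀ M : ℝ≥0, ∫⁻ L, min (latticeSum (siegelFun e q) L) M ∂μ ≤
      ∫⁻ y, siegelFun e q y := by
    intro M
    have hle : ∀ j, ∫⁻ L, min (latticeSum (siegelFun e q) L) M ∂μ ≤
        ∫⁻ L, min (∫⁻ s, φ s * latticeSum (siegelFun e q) (h j s • L)) M ∂μ := by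
      intro j
      have hinv : ∀ s, ∫⁻ L, min (latticeSum (siegelFun e q) (h j s • L)) M ∂μ =
          ∫⁻ L, min (latticeSum (siegelFun e q) L) M ∂μ := fun s => by
        have hc : Measurable fun L : LatticeSpace n => h j s • L :=
          (continuous_const_smul _).measurable
        conv_rhs => rw [← hμ (h j s)]
        rw [lintegral_map (hF.min measurable_const) hc]
      calc ∫⁻ L, min (latticeSum (siegelFun e q) L) M ∂μ
          = ∫⁻ s, φ s * ∫⁻ L, min (latticeSum (siegelFun e q) (h j s • L)) M ∂μ := by
            simp_rw [hinv]
            rw [lintegral_mul_const _ hφm, hφ1, one_mul]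
        _ = ∫⁻ s, ∫⁻ L, φ s * min (latticeSum (siegelFun e q) (h j s • L)) M ∂μ := by
            refine lintegral_congr fun s => (lintegral_const_mul _ ?_).symm
            exact ((hjoint j).comp measurable_prodMk_left).min measurable_const
        _ = ∫⁻ L, ∫⁻ s, φ s * min (latticeSum (siegelFun e q) (h j s • L)) M ∂volume ∂μ := by
            refine lintegral_lintegral_swap (Measurable.aemeasurable ?_)
            exact (hφm.comp measurable_fst).mul ((hjoint j).min measurable_const)
        _ ≤ _ := by
            refine lintegral_mono fun L => le_min ?_ ?_
            · exact lintegral_mono fun s => mul_le_mul_right (min_le_left _ _) _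
            · calc ∫⁻ s, φ s * min (latticeSum (siegelFun e q) (h j s • L)) M
                  ≤ ∫⁻ s, φ s * (M : ℝ≥0∞) :=
                    lintegral_mono fun s => mul_le_mul_right (min_le_right _ _) _
                _ = M := by rw [lintegral_mul_const _ hφm, hφ1, one_mul]
    have htend : Tendsto (fun j => ∫⁻ L, min (∫⁻ s, φ s *
        latticeSum (siegelFun e q) (h j s • L)) M ∂μ) atTop
        (𝓝 (∫⁻ _L, min (∫⁻ y, siegelFun e q y) M ∂μ)) := by
      refine tendsto_lintegral_of_dominated_convergence (fun _ => (M : ℝ≥0∞)) (fun j => ?_)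
        (fun j => Eventually.of_forall fun L => min_le_right _ _) ?_
        (Eventually.of_forall fun L => (hlim L).min tendsto_const_nhds)
      · exact (Measurable.lintegral_prod_left'
          ((hφm.comp measurable_fst).mul (hjoint j))).min measurable_const
      · simp
    refine (ge_of_tendsto' htend hle).trans ?_
    simp
  have hsup : ∀ L, latticeSum (siegelFun e q) L =
      ⨆ M : ℕ, min (latticeSum (siegelFun e q) L) M := fun L => by
    rw [← inf_iSup_eq, ENNReal.iSup_natCast, inf_top_eq]
  rw [lintegral_congr hsup, lintegral_iSup]
  · exact iSup_le fun M => by exact_mod_cast hmin M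
  · exact fun M => hF.min measurable_const
  · exact fun M N hMN L => min_le_min le_rfl (by exact_mod_cast hMN)


theorem tsum_iSup_of_monotone {ι : Type*} {f : ℕ → ι → ℝ≥0∞} (hf : ∀ v, Monotone fun j => f j v) :
    ∑' v, ⨆ j, f j v = ⨆ j, ∑' v, f j v := by
  let _ : MeasurableSpace ι := ⊤
  simp_rw [← lintegral_count]
  exact lintegral_iSup (fun _ => measurable_from_top) fun i j hij v => hf v hij

theorem exists_monotone_approx {E : Type*} [NormedAddCommGroup E] [ProperSpace E] {U : Set E}
    (hU : IsOpen U) (hne : Uᶜ.Nonempty) :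
    ∃ q : ℕ → E → ℝ≥0, (∀ j, Continuous (q j)) ∧ (∀ j, HasCompactSupport (q j)) ∧
      (∀ j, tsupport (q j) ⊆ U) ∧ (∀ x, Monotone fun j => q j x) ∧
      ∀ x, ⨆ j, (q j x : ℝ≥0∞) = U.indicator 1 x := by
  let q : ℕ → E → ℝ≥0 := fun j x =>
    (min 1 (j * Metric.infDist x Uᶜ - 1)).toNNReal * (min 1 (j - ‖x‖)).toNNReal
  have hpos : ∀ j x, q j x ≠ 0 → 1 ≤ j * Metric.infDist x Uᶜ ∧ ‖x‖ ≤ j := by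
    intro j x h
    obtain ⟨h1, h2⟩ := mul_ne_zero_iff.1 h
    have h1' := lt_min_iff.1 (Real.toNNReal_pos.1 (pos_iff_ne_zero.2 h1))
    have h2' := lt_min_iff.1 (Real.toNNReal_pos.1 (pos_iff_ne_zero.2 h2))
    exact ⟨by linarith, by linarith⟩
  have hmem : ∀ (j : ℕ) x, 1 ≤ j * Metric.infDist x Uᶜ → x ∈ U := by
    intro j x h
    by_contra hx
    rw [Metric.infDist_zero_of_mem (s := Uᶜ) hx, mul_zero] at h
    linarith
  have hle : ∀ j x, q j x ≤ 1 := fun j x =>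
    mul_le_one' (Real.toNNReal_le_one.2 (min_le_left _ _))
      (Real.toNNReal_le_one.2 (min_le_left _ _))
  have hmono : ∀ x, Monotone fun j => q j x := by
    intro x i j hij
    have hij' : (i : ℝ) ≤ j := by exact_mod_cast hij
    have := Metric.infDist_nonneg (x := x) (s := Uᶜ)
    dsimp only [q]
    gcongr
  have hsub : ∀ j, tsupport (q j) ⊆ {x | 1 ≤ j * Metric.infDist x Uᶜ} ∩ Metric.closedBall 0 j := by
    intro j
    have hc : IsClosed {x | 1 ≤ j * Metric.infDist x Uᶜ} := isClosed_le continuous_const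
      (continuous_const.mul (Metric.continuous_infDist_pt _))
    refine closure_minimal (fun x hx => ?_) (hc.inter Metric.isClosed_closedBall)
    obtain ⟨h1, h2⟩ := hpos j x hx
    exact ⟨h1, mem_closedBall_zero_iff.2 h2⟩
  refine ⟨q, fun j => ?_, fun j => ?_, fun j x hx => hmem j x (hsub j hx).1, hmono, fun x => ?_⟩
  · have h1 : Continuous fun x => Metric.infDist x Uᶜ := Metric.continuous_infDist_pt _
    dsimp only [q]
    fun_prop
  · exact (isCompact_closedBall (0 : E) j).of_isClosed_subset (isClosed_tsupport _)
      fun x hx => (hsub j hx).2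
  · by_cases hx : x ∈ U
    · rw [Set.indicator_of_mem hx, Pi.one_apply]
      refine le_antisymm (iSup_le fun j => by exact_mod_cast hle j x) ?_
      have hd : 0 < Metric.infDist x Uᶜ :=
        (hU.isClosed_compl.notMem_iff_infDist_pos hne).1 (fun h => h hx)
      obtain ⟨j, hj⟩ := exists_nat_ge (max (2 / Metric.infDist x Uᶜ) (1 + ‖x‖))
      have h1 : 2 ≤ j * Metric.infDist x Uᶜ := (div_le_iff₀ hd).1 ((le_max_left _ _).trans hj)
      have h2 : 1 + ‖x‖ ≤ j := (le_max_right _ _).trans hj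
      refine le_iSup_of_le j ?_
      have : q j x = 1 := by
        dsimp only [q]
        rw [min_eq_left (by linarith), min_eq_left (by linarith), Real.toNNReal_one, mul_one]
      rw [this, ENNReal.coe_one]
    · rw [Set.indicator_of_notMem hx]
      simp only [ENNReal.iSup_eq_zero, ENNReal.coe_eq_zero]
      intro j
      by_contra h
      exact hx (hmem j x (hpos j x h).1)

theorem lintegral_latticeSum_indicator_block_le [IsProbabilityMeasure μ]
    (hμ : ∀ g : SLR n, Measure.map (fun x => g • x) μ = μ) (hk : 1 ≤ k) (hm : 1 ≤ m)
    (e : Fin k ⊕ Fin m ≃ Fin n) {W : Set (Fin k → Fin n → ℝ)} (hW : IsOpen W) :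
    ∫⁻ L, latticeSum ((W ∩ {y | blockDet (tupleSplit e y).1 ≠ 0}).indicator 1) L ∂μ ≤
      volume W := by
  let U : Set ((Fin k → Fin k → ℝ) × (Fin k → Fin m → ℝ)) :=
    {p | blockDet p.1 ≠ 0 ∧ tupleJoin e (p.1, blockMul (Matrix.of p.1) p.2) ∈ W}
  have hU : IsOpen U := by
    refine IsOpen.inter ?_ ?_
    · exact isOpen_ne_fun (continuous_blockDet.comp continuous_fst) continuous_const
    · refine hW.preimage ((continuous_tupleJoin e).comp (Continuous.prodMk (by fun_prop) ?_))
      unfold blockMul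
      simp only [Matrix.of_apply]
      fun_prop
  have hne : Uᶜ.Nonempty := by
    refine ⟨0, fun h => h.1 ?_⟩
    have : Nonempty (Fin k) := ⟨⟨0, hk⟩⟩
    exact Matrix.det_zero
  obtain ⟨q, hq, hqc, hqU, hmono, hsup⟩ := exists_monotone_approx hU hne
  have hqs : ∀ j, tsupport (q j) ⊆ {p | blockDet p.1 ≠ 0} := fun j p hp => (hqU j hp).1
  have hind : ∀ y, ((W ∩ {y | blockDet (tupleSplit e y).1 ≠ 0}).indicator 1 y : ℝ≥0∞) =
      ⨆ j, siegelFun e (q j) y := by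
    intro y
    simp only [siegelFun, hsup]
    by_cases hy : blockDet (tupleSplit e y).1 = 0
    · rw [Set.indicator_of_notMem (fun h => h.2 hy), Set.indicator_of_notMem (fun h => h.1 hy)]
    · have hu : IsUnit (Matrix.of (tupleSplit e y).1).det := isUnit_iff_ne_zero.2 hy
      have : tupleJoin e ((tupleSplit e y).1, blockMul (Matrix.of (tupleSplit e y).1)
          (blockMul (Matrix.of (tupleSplit e y).1)⁻¹ (tupleSplit e y).2)) = y := by
        rw [blockMul_blockMul, Matrix.mul_nonsing_inv _ hu, blockMul_one, Prod.mk.eta,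
          tupleJoin_tupleSplit]
      classical
      simp only [Set.indicator_apply, U, Set.mem_inter_iff, Set.mem_ofPred_eq, this, Pi.one_apply,
        and_comm]
  have hmono' : ∀ y, Monotone fun j => siegelFun e (q j) y := fun y i j hij =>
    ENNReal.coe_le_coe.2 (hmono _ hij)
  have hsum : ∀ L, latticeSum ((W ∩ {y | blockDet (tupleSplit e y).1 ≠ 0}).indicator 1) L =
      ⨆ j, latticeSum (siegelFun e (q j)) L := fun L => by
    simp only [latticeSum, tupleSum, hind]
    exact tsum_iSup_of_monotone fun v => hmono' _
  rw [lintegral_congr hsum, lintegral_iSup]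
  · refine iSup_le fun j => (lintegral_latticeSum_siegelFun_le hμ hm (hq j) (hqc j)
      (hqs j)).trans ?_
    rw [← lintegral_indicator_one hW.measurableSet]
    refine lintegral_mono fun y => (le_iSup (fun j => siegelFun e (q j) y) j).trans ?_
    rw [← hind]
    exact Set.indicator_le_indicator_of_subset Set.inter_subset_left (fun _ => zero_le) y
  · exact fun j => measurable_latticeSum
      (lowerSemicontinuous_siegelFun e (hq j) (blockDet_ne_zero_of_ne_zero (hqs j)))
  · exact fun i j hij L => latticeSum_mono (fun y => hmono' y hij) L

end siegelExpectation

section rogers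

variable {n k m : ℕ}

instance : (volume : Measure (Fin k → Fin n → ℝ)).Regular :=
  Measure.Regular.of_sigmaCompactSpace_of_isLocallyFiniteMeasure _

theorem volume_blockDet_eq_zero : volume {P : Fin k → Fin k → ℝ | blockDet P = 0} = 0 := by
  set A : Set (Fin k → Fin k → ℝ) := {P | blockDet P = 0}
  let D : Fin k → Fin k → ℝ := fun i j => (1 : Matrix (Fin k) (Fin k) ℝ) i j
  have hA : MeasurableSet A := (isClosed_eq continuous_blockDet continuous_const).measurableSet
  have hfin : ∀ P : Fin k → Fin k → ℝ, {τ : ℝ | P + τ • D ∈ A}.Finite := by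
    intro P
    have hne : (-Matrix.of P).charpoly ≠ 0 := (Matrix.charpoly_monic _).ne_zero
    refine (Polynomial.finite_setOfPred_isRoot hne).subset fun τ hτ => ?_
    change Polynomial.eval τ _ = 0
    rw [Matrix.eval_charpoly, sub_neg_eq_add, add_comm]
    convert (show blockDet (P + τ • D) = 0 from hτ) using 1
    rw [blockDet]
    congr 1
    ext i j
    simp [D, Matrix.one_apply, Matrix.diagonal_apply]
  have hmeas : Measurable fun p : ℝ × (Fin k → Fin k → ℝ) =>
      A.indicator (1 : (Fin k → Fin k → ℝ) → ℝ≥0∞)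
      (p.2 + p.1 • D) := (measurable_const.indicator hA).comp
        (by fun_prop : Measurable fun p : ℝ × (Fin k → Fin k → ℝ) => p.2 + p.1 • D)
  have h1 : ∫⁻ τ : ℝ in Set.Icc 0 1, ∫⁻ P : Fin k → Fin k → ℝ,
      A.indicator (1 : (Fin k → Fin k → ℝ) → ℝ≥0∞) (P + τ • D) = volume A := by
    simp_rw [lintegral_add_right_eq_self (fun P => A.indicator (1 : (Fin k → Fin k → ℝ) → ℝ≥0∞) P),
      lintegral_indicator_one hA]
    simp
  rw [← h1, lintegral_lintegral_swap hmeas.aemeasurable]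
  refine (lintegral_congr fun P => ?_).trans lintegral_zero
  have h2 : (fun τ : ℝ => A.indicator (1 : (Fin k → Fin k → ℝ) → ℝ≥0∞) (P + τ • D)) =
      {τ : ℝ | P + τ • D ∈ A}.indicator 1 := rfl
  rw [h2, lintegral_indicator_one (hfin P).measurableSet]
  exact ((hfin P).countable.measure_zero _)

theorem volume_blockDet_tupleSplit_eq_zero (e : Fin k ⊕ Fin m ≃ Fin n) :
    volume {y : Fin k → Fin n → ℝ | blockDet (tupleSplit e y).1 = 0} = 0 := by
  have hA : MeasurableSet {P : Fin k → Fin k → ℝ | blockDet P = 0} :=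
    (isClosed_eq continuous_blockDet continuous_const).measurableSet
  have h := (measurePreserving_tupleSplit e).measure_preimage
    ((hA.prod MeasurableSet.univ).nullMeasurableSet)
  rw [Measure.volume_eq_prod, Measure.prod_prod, volume_blockDet_eq_zero, zero_mul] at h
  convert h using 2
  ext y
  simp

theorem exists_blockDet_ne_zero (hkm : k + m = n) {y : Fin k → Fin n → ℝ}
    (hy : LinearIndependent ℝ y) :
    ∃ e : Fin k ⊕ Fin m ≃ Fin n, blockDet (tupleSplit e y).1 ≠ 0 := by
  obtain ⟨κ, a, ha, hsp, hli⟩ := exists_linearIndependent' ℝ (Matrix.of y).col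
  have : Finite κ := Finite.of_injective a ha
  have : Fintype κ := Fintype.ofFinite κ
  have hrank : (Matrix.of y).rank = k := by
    have : LinearIndependent ℝ (Matrix.of y).row := hy
    simpa using this.rank_matrix
  have hcard : Fintype.card κ = Fintype.card (Fin k) := by
    rw [linearIndependent_iff_card_eq_finrank_span.1 hli, Set.finrank, hsp, Fintype.card_fin,
      ← Matrix.rank_eq_finrank_span_cols, hrank]
  let c : Fin k ≃ κ := (Fintype.equivOfCardEq hcard).symm
  have hinj : Function.Injective (a ∘ c) := ha.comp c.injective
  have hcompl : Fintype.card (Fin m) = Fintype.card ↥(Set.range (a ∘ c))ᶜ := by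
    classical
    rw [Fintype.card_compl_set, Set.card_range_of_injective hinj]
    simp only [Fintype.card_fin]
    omega
  classical
  let e : Fin k ⊕ Fin m ≃ Fin n := ((Equiv.ofInjective _ hinj).sumCongr
    (Fintype.equivOfCardEq hcompl)).trans (Equiv.Set.sumCompl (Set.range (a ∘ c)))
  have he : ∀ j, e (.inl j) = a (c j) := fun j => by simp [e]
  refine ⟨e, ?_⟩
  have hcol : LinearIndependent ℝ (Matrix.of (tupleSplit e y).1).col := by
    have : (Matrix.of (tupleSplit e y).1).col = ((Matrix.of y).col ∘ a) ∘ c := by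
      funext j i
      simp only [Matrix.col, tupleSplit, he, Function.comp_apply, Matrix.transpose_apply,
        Matrix.of_apply]
      rfl
    rw [this]
    exact hli.comp c c.injective
  exact ((Matrix.isUnit_iff_isUnit_det _).1
    (Matrix.linearIndependent_cols_iff_isUnit.1 hcol)).ne_zero

theorem latticeSum_add (F G : (Fin k → Fin n → ℝ) → ℝ≥0∞) (L : LatticeSpace n) :
    latticeSum (F + G) L = latticeSum F L + latticeSum G L := ENNReal.tsum_add

theorem latticeSum_sum {ι : Type*} (s : Finset ι) (F : ι → (Fin k → Fin n → ℝ) → ℝ≥0∞)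
    (L : LatticeSpace n) : latticeSum (∑ i ∈ s, F i) L = ∑ i ∈ s, latticeSum (F i) L := by
  simp only [latticeSum, tupleSum, Finset.sum_apply]
  exact Summable.tsum_finsetSum fun _ _ => ENNReal.summable

/-- The mean value inequality for sums over linearly independent tuples of lattice vectors. -/
theorem lintegral_latticeSum_indicator_le {μ : Measure (LatticeSpace n)} [IsProbabilityMeasure μ]
    (hμ : ∀ g : SLR n, Measure.map (fun x => g • x) μ = μ) (hk : 1 ≤ k) (hkn : k < n)
    {W : Set (Fin k → Fin n → ℝ)} (hW : IsOpen W) :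
    ∫⁻ L, latticeSum ((W ∩ {y | LinearIndependent ℝ y}).indicator 1) L ∂μ ≤ volume W := by
  obtain ⟨m, rfl⟩ : ∃ m, n = k + (m + 1) := ⟨n - k - 1, by omega⟩
  let e₀ : Fin k ⊕ Fin (m + 1) ≃ Fin (k + (m + 1)) := finSumFinEquiv
  refine ENNReal.le_of_forall_pos_le_add fun ε hε _ => ?_
  let ν : ℕ := Fintype.card (Fin k ⊕ Fin (m + 1) ≃ Fin (k + (m + 1)))
  let N : ℝ≥0∞ := ν
  have hN0 : N ≠ 0 := by
    simp only [N, ν, ne_eq, Nat.cast_eq_zero]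
    exact (Fintype.card_pos_iff.2 ⟨e₀⟩).ne'
  have hN : N ≠ ⊤ := ENNReal.natCast_ne_top _
  have hpos : 0 < (ε : ℝ≥0∞) / N := ENNReal.div_pos (by simpa using hε.ne') hN
  obtain ⟨V, hV, hVo, hVlt⟩ := Set.exists_isOpen_lt_of_lt _ _
    ((volume_blockDet_tupleSplit_eq_zero e₀).trans_lt hpos)
  let Ω : (Fin k ⊕ Fin (m + 1) ≃ Fin (k + (m + 1))) → Set (Fin k → Fin (k + (m + 1)) → ℝ) :=
    fun e => {y | blockDet (tupleSplit e y).1 ≠ 0}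
  have hΩ : ∀ e, IsOpen (Ω e) := fun e => isOpen_ne_fun
    (continuous_blockDet.comp (continuous_fst.comp (continuous_tupleSplit e))) continuous_const
  have hle : ∀ y, (W ∩ {y | LinearIndependent ℝ y}).indicator
      (1 : (Fin k → Fin (k + (m + 1)) → ℝ) → ℝ≥0∞) y ≤
      ((W ∩ Ω e₀).indicator 1 + ∑ e, (V ∩ Ω e).indicator 1 :
        (Fin k → Fin (k + (m + 1)) → ℝ) → ℝ≥0∞) y := by
    intro y
    by_cases hy : y ∈ W ∩ {y | LinearIndependent ℝ y}
    · rw [Set.indicator_of_mem hy, Pi.add_apply, Finset.sum_apply]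
      by_cases h0 : y ∈ Ω e₀
      · have hmem : y ∈ W ∩ Ω e₀ := ⟨hy.1, h0⟩
        rw [Set.indicator_of_mem hmem]
        exact le_self_add
      · obtain ⟨e, he⟩ := exists_blockDet_ne_zero rfl hy.2
        refine le_add_of_nonneg_of_le zero_le ?_
        have hmem : y ∈ V ∩ Ω e := ⟨hV (not_not.1 h0), he⟩
        refine le_trans ?_ (Finset.single_le_sum (fun _ _ => zero_le) (Finset.mem_univ e))
        rw [Set.indicator_of_mem hmem]
    · rw [Set.indicator_of_notMem hy]
      exact zero_le
  have hmeas : ∀ U : Set (Fin k → Fin (k + (m + 1)) → ℝ), IsOpen U →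
      Measurable (latticeSum (n := k + (m + 1)) (U.indicator 1)) := fun U hU =>
    measurable_latticeSum (hU.lowerSemicontinuous_indicator zero_le)
  calc ∫⁻ L, latticeSum ((W ∩ {y | LinearIndependent ℝ y}).indicator 1) L ∂μ
      ≤ ∫⁻ L, (latticeSum ((W ∩ Ω e₀).indicator 1) L +
          ∑ e, latticeSum ((V ∩ Ω e).indicator 1) L) ∂μ := by
        refine lintegral_mono fun L => (latticeSum_mono hle L).trans_eq ?_
        rw [latticeSum_add, latticeSum_sum]
    _ ≤ volume W + N * volume V := by
        rw [lintegral_add_left (hmeas _ (hW.inter (hΩ _))),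
          lintegral_finsetSum _ fun e _ => hmeas _ (hVo.inter (hΩ e))]
        refine add_le_add
          (lintegral_latticeSum_indicator_block_le hμ hk (by omega) e₀ hW) ?_
        refine (Finset.sum_le_sum fun e _ =>
          lintegral_latticeSum_indicator_block_le hμ hk (by omega) e hVo).trans_eq ?_
        rw [Finset.sum_const, nsmul_eq_mul, Finset.card_univ]
    _ ≤ volume W + ε := by
        gcongr
        refine (mul_le_mul_right hVlt.le N).trans_eq ?_
        exact ENNReal.mul_div_cancel hN0 hN

end rogers

section relationMatrix

variable {n k m : ℕ}

/-- `(q, a)` encodes a primitive linear relation `q u = ∑ aᵢ vᵢ` between lattice vectors in which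
`q` is the largest coefficient and, if `q = 1`, at least two of the `aᵢ` do not vanish. -/
structure IsRelationType (q : ℕ) (a : Fin k → ℤ) : Prop where
  pos : 0 < q
  abs_le : ∀ i, |a i| ≤ q
  isUnit_of_dvd : ∀ d : ℤ, d ∣ q → (∀ i, d ∣ a i) → IsUnit d
  exists_ne : q = 1 → ∃ i j, i ≠ j ∧ a i ≠ 0 ∧ a j ≠ 0

theorem IsRelationType.comp_perm {q : ℕ} {a : Fin k → ℤ} (h : IsRelationType q a)
    (σ : Equiv.Perm (Fin k)) : IsRelationType q (a ∘ σ) where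
  pos := h.pos
  abs_le i := h.abs_le _
  isUnit_of_dvd d hd hda := h.isUnit_of_dvd d hd fun i => by simpa using hda (σ.symm i)
  exists_ne hq := by
    obtain ⟨i, j, hij, hi, hj⟩ := h.exists_ne hq
    exact ⟨σ.symm i, σ.symm j, by simpa using hij, by simpa using hi, by simpa using hj⟩

/-- The integer vectors `c` with `q ∣ ∑ aᵢ cᵢ` form a lattice whose index is a multiple of `q`. -/
theorem exists_relationMatrix {q : ℕ} (hq : 0 < q) {a : Fin k → ℤ}
    (ha : ∀ d : ℤ, d ∣ q → (∀ i, d ∣ a i) → IsUnit d) :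
    ∃ B : Matrix (Fin k) (Fin k) ℤ, B.det ≠ 0 ∧ (q : ℤ) ∣ B.det ∧
      ∀ c : Fin k → ℤ, (q : ℤ) ∣ ∑ i, a i * c i → ∃ d, c = B.mulVec d := by
  have hq0 : (q : ℤ) ≠ 0 := by exact_mod_cast hq.ne'
  let N : Submodule ℤ (Fin k → ℤ) :=
    { carrier := {c | (q : ℤ) ∣ ∑ i, a i * c i}
      zero_mem' := by simp
      add_mem' := fun {x y} hx hy => by
        simp only [Set.mem_ofPred_eq, Pi.add_apply, mul_add, Finset.sum_add_distrib] at *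
        exact dvd_add hx hy
      smul_mem' := fun r x hx => by
        simp only [Set.mem_ofPred_eq, Pi.smul_apply, smul_eq_mul] at *
        have : ∑ i, a i * (r * x i) = r * ∑ i, a i * x i := by
          rw [Finset.mul_sum]; exact Finset.sum_congr rfl fun i _ => by ring
        rw [this]
        exact hx.mul_left _ }
  have hqN : ∀ c : Fin k → ℤ, (q : ℤ) • c ∈ N := fun c =>
    Finset.dvd_sum fun i _ => (dvd_mul_right _ _).mul_left _
  have hrank : Module.finrank ℤ N = k := by
    refine le_antisymm ((Submodule.finrank_le N).trans_eq (by simp)) ?_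
    have hinj : Function.Injective
        ((LinearMap.lsmul ℤ (Fin k → ℤ) (q : ℤ)).codRestrict N hqN) := fun x y hxy => by
      have := congrArg Subtype.val hxy
      exact smul_right_injective _ hq0 this
    simpa using LinearMap.finrank_le_finrank_of_injective hinj
  let b := Module.finBasisOfFinrankEq ℤ N hrank
  let B : Matrix (Fin k) (Fin k) ℤ := Matrix.of fun i j => (b j : Fin k → ℤ) i
  have hB : ∀ c ∈ N, ∃ d, c = B.mulVec d := fun c hc => by
    refine ⟨b.repr ⟨c, hc⟩, ?_⟩
    have := congrArg (fun x : N => (x : Fin k → ℤ)) (b.sum_repr ⟨c, hc⟩)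
    simp only [Submodule.coe_sum, Submodule.coe_smul] at this
    refine this.symm.trans ?_
    funext i
    rw [Finset.sum_apply]
    exact Finset.sum_congr rfl fun j _ => mul_comm _ _
  choose d hd using fun i : Fin k => hB ((q : ℤ) • Pi.single i 1) (hqN _)
  have hBD : B * (Matrix.of fun i j => d j i) = (q : ℤ) • 1 := by
    ext i j
    have := congrFun (hd j) i
    simp only [Pi.smul_apply, Matrix.mulVec, dotProduct, Pi.single_apply] at this
    simp [Matrix.mul_apply, ← this, Matrix.one_apply]
  have hdet : B.det ≠ 0 := fun h => by
    have := congrArg Matrix.det hBD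
    rw [Matrix.det_mul, h, zero_mul, Matrix.det_smul, Matrix.det_one, mul_one] at this
    exact pow_ne_zero _ hq0 this.symm
  have hdvd : ∀ j, (q : ℤ) ∣ Matrix.vecMul a B j := fun j => (b j).2
  choose r hr using hdvd
  have hvec : Matrix.vecMul a B = (q : ℤ) • r := by ext j; simp [hr]
  have hadj : ∀ i, (q : ℤ) ∣ a i * B.det := fun i => by
    have h := congrFun (congrArg (fun x => Matrix.vecMul x B.adjugate) hvec) i
    simp only [Matrix.vecMul_vecMul, Matrix.mul_adjugate, Matrix.vecMul_smul, Matrix.smul_vecMul,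
      Matrix.vecMul_one, Pi.smul_apply, smul_eq_mul] at h
    exact ⟨_, by rw [mul_comm, h]⟩
  refine ⟨B, hdet, ?_, hB⟩
  have hg := ha (Int.gcd q (Finset.univ.gcd a)) (Int.gcd_dvd_left ..) fun i =>
    (Int.gcd_dvd_right ..).trans (Finset.gcd_dvd (Finset.mem_univ i))
  have h1 : (q : ℤ) ∣ Finset.univ.gcd a * B.det := by
    have : Finset.univ.gcd (fun i => a i * B.det) = Finset.univ.gcd a * normalize B.det :=
      Finset.gcd_mul_right
    have h2 : (q : ℤ) ∣ Finset.univ.gcd a * normalize B.det :=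
      this ▸ Finset.dvd_gcd fun i _ => hadj i
    exact h2.trans (mul_dvd_mul_left _ (normalize_dvd_iff.2 dvd_rfl))
  have hcop : IsCoprime (q : ℤ) (Finset.univ.gcd a) := by
    rw [Int.isCoprime_iff_gcd_eq_one]
    have := Int.isUnit_iff.1 hg
    omega
  exact hcop.dvd_of_dvd_mul_left h1

theorem det_blockMulLin (A : Matrix (Fin k) (Fin k) ℝ) :
    LinearMap.det (blockMulLin (m := m) A) = A.det ^ m := by
  let e : (Fin k → Fin m → ℝ) ≃ₗ[ℝ] (Fin m → Fin k → ℝ) :=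
    { toFun := fun x j i => x i j
      invFun := fun x i j => x j i
      map_add' := fun _ _ => rfl
      map_smul' := fun _ _ => rfl
      left_inv := fun _ => rfl
      right_inv := fun _ => rfl }
  have h : (e : (Fin k → Fin m → ℝ) →ₗ[ℝ] (Fin m → Fin k → ℝ)) ∘ₗ blockMulLin A ∘ₗ
      (e.symm : (Fin m → Fin k → ℝ) →ₗ[ℝ] (Fin k → Fin m → ℝ)) =
      LinearMap.pi fun j : Fin m => (Matrix.toLin' A).comp (LinearMap.proj j) := by
    apply LinearMap.ext
    intro x
    funext j i
    simp [e, blockMulLin, blockMul, Matrix.mulVec, dotProduct]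
  rw [← LinearMap.det_conj _ e, h, LinearMap.det_pi]
  simp

theorem volume_preimage_blockMul_le {q : ℕ} (hq : 0 < q) {B : Matrix (Fin k) (Fin k) ℤ}
    (hB : B.det ≠ 0) (hqB : (q : ℤ) ∣ B.det) (A : Set (Fin k → Fin n → ℝ)) :
    volume (blockMul (B.map (Int.cast : ℤ → ℝ)) ⁻¹' A) ≤ ((q : ℝ≥0∞) ^ n)⁻¹ * volume A := by
  have hcast : (B.map (Int.cast : ℤ → ℝ)).det = (B.det : ℝ) :=
    (RingHom.map_det (Int.castRingHom ℝ) B).symm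
  have hdet : LinearMap.det (blockMulLin (m := n) (B.map (Int.cast : ℤ → ℝ))) =
      (B.det : ℝ) ^ n := by
    rw [det_blockMulLin, hcast]
  have hne : LinearMap.det (blockMulLin (m := n) (B.map (Int.cast : ℤ → ℝ))) ≠ 0 := by
    rw [hdet]; exact pow_ne_zero _ (by exact_mod_cast hB)
  have h := Measure.addHaar_preimage_linearMap (volume : Measure (Fin k → Fin n → ℝ)) hne A
  refine (le_of_eq h).trans ?_
  rw [hdet]
  gcongr
  have hqd : (q : ℝ) ≤ |(B.det : ℝ)| := by
    have := Int.le_of_dvd (abs_pos.2 hB) ((dvd_abs _ _).2 hqB)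
    exact_mod_cast this
  have hq' : (0 : ℝ) < q := by exact_mod_cast hq
  rw [abs_inv, abs_pow, ENNReal.ofReal_inv_of_pos (pow_pos (hq'.trans_le hqd) _),
    ENNReal.inv_le_inv, ENNReal.ofReal_pow (abs_nonneg _)]
  gcongr
  rw [← ENNReal.ofReal_natCast]
  exact ENNReal.ofReal_le_ofReal hqd

end relationMatrix

section relationSet

variable {n k : ℕ} {S : Set (Fin n → ℝ)} {q : ℕ} {a : Fin k → ℤ}

/-- The tuples `y ∈ Sᵏ` with `q⁻¹ ∑ aᵢ yᵢ ∈ S`. -/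
def relationSet (S : Set (Fin n → ℝ)) (q : ℕ) (a : Fin k → ℤ) : Set (Fin k → Fin n → ℝ) :=
  {y | (∀ i, y i ∈ S) ∧ ∑ i, ((a i : ℝ) / q) • y i ∈ S}

theorem volume_relationSet (hS : MeasurableSet S) :
    volume (relationSet S q a) = relationVolume S (fun i => (a i : ℝ) / q) 0 := by
  have hm : MeasurableSet (relationSet S q a) := by
    have h1 : MeasurableSet {y : Fin k → Fin n → ℝ | ∀ i, y i ∈ S} := by
      have : {y : Fin k → Fin n → ℝ | ∀ i, y i ∈ S} = ⋂ i, (fun y => y i) ⁻¹' S := by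
        ext; simp
      rw [this]
      exact MeasurableSet.iInter fun i => measurable_pi_apply i hS
    have h2 : Measurable fun y : Fin k → Fin n → ℝ => ∑ i, ((a i : ℝ) / q) • y i := by fun_prop
    exact h1.inter (h2 hS)
  rw [← lintegral_indicator_one hm, relationVolume]
  refine lintegral_congr fun y => ?_
  rw [zero_add]
  by_cases h1 : ∀ i, y i ∈ S
  · have : (∏ i, S.indicator (1 : (Fin n → ℝ) → ℝ≥0∞) (y i)) = 1 :=
      Finset.prod_eq_one fun i _ => Set.indicator_of_mem (h1 i) _
    rw [this, one_mul]
    by_cases h2 : ∑ i, ((a i : ℝ) / q) • y i ∈ S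
    · rw [Set.indicator_of_mem h2, Set.indicator_of_mem (show y ∈ relationSet S q a from ⟨h1, h2⟩)]
      rfl
    · rw [Set.indicator_of_notMem h2, Set.indicator_of_notMem fun h => h2 h.2]
  · rw [Set.indicator_of_notMem fun h => h1 h.1]
    push Not at h1
    obtain ⟨i, hi⟩ := h1
    rw [Finset.prod_eq_zero (Finset.mem_univ i) (Set.indicator_of_notMem hi _), zero_mul]

/-- The gain over the trivial bound `vol(S)ᵏ` coming from a relation with denominator `q`. -/
def relationWeight (n q : ℕ) : ℝ≥0∞ :=
  if q = 0 then 0 else if q = 1 then youngConst ^ n else ((q : ℝ≥0∞) ^ n)⁻¹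

theorem IsRelationType.exists_isOpen (h : IsRelationType q a) (hS : MeasurableSet S)
    (hS0 : volume S ≠ 0) (hS1 : volume S ≠ ∞) :
    ∃ (B : Matrix (Fin k) (Fin k) ℤ) (W : Set (Fin k → Fin n → ℝ)), IsOpen W ∧
      blockMul (B.map (Int.cast : ℤ → ℝ)) ⁻¹' relationSet S q a ⊆ W ∧
      volume W ≤ 2 * volume S ^ k * relationWeight n q ∧
      ∀ c : Fin k → ℤ, (q : ℤ) ∣ ∑ i, a i * c i → ∃ d, c = B.mulVec d := by
  obtain ⟨B, hB, hqB, hBd⟩ := exists_relationMatrix h.pos h.isUnit_of_dvd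
  have hy0 : youngConst ≠ 0 := by
    simp only [youngConst, ne_eq, ENNReal.ofReal_eq_zero, not_le]; positivity
  have hw0 : relationWeight n q ≠ 0 := by
    rw [relationWeight, if_neg h.pos.ne']
    split_ifs
    · exact pow_ne_zero _ hy0
    · exact ENNReal.inv_ne_zero.2 (ENNReal.pow_ne_top (ENNReal.natCast_ne_top _))
  have hw1 : relationWeight n q ≠ ∞ := by
    rw [relationWeight, if_neg h.pos.ne']
    split_ifs
    · exact ENNReal.pow_ne_top ENNReal.ofReal_ne_top
    · exact ENNReal.inv_ne_top.2 (pow_ne_zero _ (by exact_mod_cast h.pos.ne'))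
  have hle : volume (blockMul (B.map (Int.cast : ℤ → ℝ)) ⁻¹' relationSet S q a) ≤
      volume S ^ k * relationWeight n q := by
    refine (volume_preimage_blockMul_le h.pos hB hqB _).trans ?_
    rw [volume_relationSet hS, relationWeight, if_neg h.pos.ne']
    split_ifs with h1
    · obtain ⟨i, j, hij, hi, hj⟩ := h.exists_ne h1
      subst h1
      simp only [Nat.cast_one, one_pow, inv_one, one_mul, div_one]
      rw [mul_comm]
      refine relationVolume_le hS (fun i => ?_) ⟨i, j, hij, by exact_mod_cast hi,
        by exact_mod_cast hj⟩ 0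
      have := h.abs_le i
      by_cases h0 : a i = 0
      · exact Or.inl (by exact_mod_cast h0)
      · have h2 : |a i| = 1 := le_antisymm (by simpa using this) (Int.one_le_abs h0)
        exact Or.inr (by exact_mod_cast h2)
    · rw [mul_comm]
      gcongr
      exact relationVolume_le_pow hS _ _
  have hlt : volume S ^ k * relationWeight n q < 2 * volume S ^ k * relationWeight n q := by
    rw [mul_assoc, two_mul]
    exact ENNReal.lt_add_right (ENNReal.mul_ne_top (ENNReal.pow_ne_top hS1) hw1)
      (mul_ne_zero (pow_ne_zero _ hS0) hw0)
  obtain ⟨W, hW, hWo, hWv⟩ := Set.exists_isOpen_lt_of_lt _ _ (hle.trans_lt hlt)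
  exact ⟨B, W, hWo, hW, hWv.le, hBd⟩

/-- There are `k` independent lattice vectors in `S` and a further lattice vector in `S` which is
dependent on them, through a relation as in `IsRelationType`. -/
def HasRelation (k : ℕ) (S : Set (Fin n → ℝ)) (g : SLR n) : Prop :=
  ∃ (q : ℕ) (a : Fin k → ℤ) (v : Fin k → Fin n → ℤ) (u : Fin n → ℤ), IsRelationType q a ∧
    LinearIndependent ℝ (tupleAct g.1 (tupleCast v)) ∧ (∀ i, tupleAct g.1 (tupleCast v) i ∈ S) ∧
    g.1.mulVec (fun j => (u j : ℝ)) ∈ S ∧ ∀ j, (q : ℤ) * u j = ∑ i, a i * v i j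

theorem exists_tuple_mem_of_relation {g : SLR n} {v : Fin k → Fin n → ℤ} {u : Fin n → ℤ}
    {B : Matrix (Fin k) (Fin k) ℤ} {W : Set (Fin k → Fin n → ℝ)} (hq : 0 < q)
    (hW : blockMul (B.map (Int.cast : ℤ → ℝ)) ⁻¹' relationSet S q a ⊆ W)
    (hB : ∀ c : Fin k → ℤ, (q : ℤ) ∣ ∑ i, a i * c i → ∃ d, c = B.mulVec d)
    (hv : LinearIndependent ℝ (tupleAct g.1 (tupleCast v)))
    (hvS : ∀ i, tupleAct g.1 (tupleCast v) i ∈ S)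
    (hu : g.1.mulVec (fun j => (u j : ℝ)) ∈ S) (huv : ∀ j, (q : ℤ) * u j = ∑ i, a i * v i j) :
    ∃ w : Fin k → Fin n → ℤ, (v = fun i j => B.mulVec (fun l => w l j) i) ∧
      tupleAct g.1 (tupleCast w) ∈ W ∩ {y | LinearIndependent ℝ y} := by
  choose d hd using fun j => hB (fun i => v i j) ⟨u j, (huv j).symm⟩
  have hvd : v = fun i j => B.mulVec (fun l => d j l) i := by
    funext i j
    exact congrFun (hd j) i
  refine ⟨fun l j => d j l, hvd, ?_⟩
  set w : Fin k → Fin n → ℤ := fun l j => d j l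
  have hblock : tupleAct g.1 (tupleCast v) =
      blockMul (B.map (Int.cast : ℤ → ℝ)) (tupleAct g.1 (tupleCast w)) := by
    funext i j
    simp only [tupleAct, tupleCast, blockMul, Matrix.mulVec, dotProduct, hvd, Matrix.map_apply,
      Int.cast_sum, Int.cast_mul, Finset.mul_sum, w]
    rw [Finset.sum_comm]
    exact Finset.sum_congr rfl fun _ _ => Finset.sum_congr rfl fun _ _ => by ring
  refine ⟨hW ?_, ?_⟩
  · rw [Set.mem_preimage, ← hblock]
    refine ⟨hvS, ?_⟩
    convert hu using 1
    have hq' : (q : ℝ) ≠ 0 := by exact_mod_cast hq.ne'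
    have hu' : (fun j => (u j : ℝ)) = ∑ i, ((a i : ℝ) / q) • tupleCast v i := by
      funext j
      have : (q : ℝ) * u j = ∑ i, (a i : ℝ) * v i j := by exact_mod_cast huv j
      rw [Finset.sum_apply]
      simp only [Pi.smul_apply, smul_eq_mul, tupleCast, div_mul_eq_mul_div, ← Finset.sum_div]
      rw [← this]
      field_simp
    rw [hu', Matrix.mulVec_sum]
    exact Finset.sum_congr rfl fun i _ => by rw [Matrix.mulVec_smul]; rfl
  · rw [Set.mem_ofPred_eq, linearIndependent_iff_card_le_finrank_span]
    have h1 := linearIndependent_iff_card_le_finrank_span.1 hv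
    refine h1.trans (Submodule.finrank_mono (Submodule.span_le.2 ?_))
    rintro _ ⟨i, rfl⟩
    rw [hblock]
    have : blockMul (B.map (Int.cast : ℤ → ℝ)) (tupleAct g.1 (tupleCast w)) i =
        ∑ l, (B i l : ℝ) • tupleAct g.1 (tupleCast w) l := by
      funext j
      simp [blockMul]
    rw [this]
    exact Submodule.sum_mem _ fun l _ => Submodule.smul_mem _ _ (Submodule.subset_span ⟨l, rfl⟩)

theorem measurable_latticeSum_inter_linearIndependent {W : Set (Fin k → Fin n → ℝ)}
    (hW : IsOpen W) : Measurable (latticeSum (n := n)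
      ((W ∩ {y | LinearIndependent ℝ y}).indicator (1 : (Fin k → Fin n → ℝ) → ℝ≥0∞))) :=
  measurable_latticeSum ((hW.inter isOpen_setOfPred_linearIndependent).lowerSemicontinuous_indicator
    zero_le_one)

end relationSet

section measureHasRelation

variable {n k : ℕ} {S : Set (Fin n → ℝ)}

/-- The relation types with `k` coefficients. -/
abbrev RelationType (k : ℕ) := {p : ℕ × (Fin k → ℤ) // IsRelationType p.1 p.2}

theorem tsum_relationType_le (f : ℕ → ℝ≥0∞) :
    ∑' τ : RelationType k, f τ.1.1 ≤ ∑' q : ℕ, (2 * q + 1 : ℝ≥0∞) ^ k * f q := by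
  let box : ℕ → Finset (Fin k → ℤ) := fun q => Fintype.piFinset fun _ => Finset.Icc (-q : ℤ) q
  let ι : RelationType k → Σ q : ℕ, box q := fun τ => ⟨τ.1.1, τ.1.2, Fintype.mem_piFinset.2
    fun i => Finset.mem_Icc.2 (abs_le.1 (τ.2.abs_le i))⟩
  have hι : Function.Injective ι := by
    intro τ τ' h
    have := congrArg (fun s : Σ q : ℕ, box q => (s.1, (s.2 : Fin k → ℤ))) h
    exact Subtype.ext this
  refine (ENNReal.tsum_comp_le_tsum_of_injective hι fun s => f s.1).trans ?_
  rw [ENNReal.tsum_sigma']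
  refine ENNReal.tsum_le_tsum fun q => ?_
  have hc : ∑' b : box q, f (⟨q, b⟩ : Σ q : ℕ, box q).1 = ∑ _b : box q, f q := tsum_fintype _
  rw [hc, Finset.sum_const, nsmul_eq_mul]
  gcongr
  have : (box q).card = (2 * q + 1) ^ k := by
    rw [Fintype.card_piFinset, Finset.prod_const, Finset.card_univ, Fintype.card_fin, Int.card_Icc]
    congr 1
    omega
  rw [Finset.card_univ, Fintype.card_coe, this]
  push_cast
  rfl

theorem factorial_le_tsum_latticeSum {W : RelationType k → Set (Fin k → Fin n → ℝ)}
    {B : RelationType k → Matrix (Fin k) (Fin k) ℤ}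
    (hW : ∀ τ, blockMul ((B τ).map (Int.cast : ℤ → ℝ)) ⁻¹' relationSet S τ.1.1 τ.1.2 ⊆ W τ)
    (hB : ∀ (τ : RelationType k) (c : Fin k → ℤ), (τ.1.1 : ℤ) ∣ ∑ i, τ.1.2 i * c i →
      ∃ d, c = (B τ).mulVec d)
    {L : LatticeSpace n} (hL : HasRelation k S (Quotient.out (α := SLR n) L)) :
    (k.factorial : ℝ≥0∞) ≤
      ∑' τ, latticeSum ((W τ ∩ {y | LinearIndependent ℝ y}).indicator 1) L := by
  obtain ⟨q, a, v, u, hqa, hv, hvS, hu, huv⟩ := hL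
  let type : Equiv.Perm (Fin k) → RelationType k := fun σ => ⟨(q, a ∘ σ), hqa.comp_perm σ⟩
  have key : ∀ σ : Equiv.Perm (Fin k), ∃ w : Fin k → Fin n → ℤ,
      ((fun i => v (σ i)) = fun i j => (B (type σ)).mulVec (fun l => w l j) i) ∧
      tupleAct (Quotient.out (α := SLR n) L).1 (tupleCast w) ∈
        W (type σ) ∩ {y | LinearIndependent ℝ y} := fun σ => by
    refine exists_tuple_mem_of_relation hqa.pos (hW (type σ)) (hB (type σ)) (v := fun i => v (σ i))
      (hv.comp σ σ.injective) (fun i => hvS (σ i)) hu fun j => ?_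
    rw [huv j]
    exact (Equiv.sum_comp σ fun i => a i * v i j).symm
  choose w hw hwW using key
  have hvinj : Function.Injective v := fun i j hij => hv.injective <| by
    have : tupleCast v i = tupleCast v j :=
      funext fun l => congrArg (Int.cast : ℤ → ℝ) (congrFun hij l)
    exact congrArg (Matrix.mulVec _) this
  let F : RelationType k × (Fin k → Fin n → ℤ) → ℝ≥0∞ := fun p =>
    (W p.1 ∩ {y | LinearIndependent ℝ y}).indicator 1
      (tupleAct (Quotient.out (α := SLR n) L).1 (tupleCast p.2))
  have hinj : Function.Injective fun σ => (type σ, w σ) := by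
    intro σ σ' h
    obtain ⟨h1, h2⟩ := Prod.mk.inj h
    refine Equiv.ext fun i => hvinj ?_
    have := hw σ
    rw [h1, h2, ← hw σ'] at this
    exact congrFun this i
  calc (k.factorial : ℝ≥0∞) = ∑' σ : Equiv.Perm (Fin k), F (type σ, w σ) := by
        have : ∀ σ, F (type σ, w σ) = 1 := fun σ => Set.indicator_of_mem (hwW σ) _
        simp_rw [this, tsum_fintype, Finset.sum_const, Finset.card_univ, Fintype.card_perm,
          Fintype.card_fin]
        simp
    _ ≤ ∑' p, F p := ENNReal.tsum_comp_le_tsum_of_injective hinj F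
    _ = ∑' τ, ∑' x, F (τ, x) := ENNReal.tsum_prod (f := fun τ x => F (τ, x))

theorem measure_hasRelation_le {μ : Measure (LatticeSpace n)} [IsProbabilityMeasure μ]
    (hμ : ∀ g : SLR n, Measure.map (fun x => g • x) μ = μ) (hk : 1 ≤ k) (hkn : k < n)
    (hS : MeasurableSet S) (hS0 : volume S ≠ 0) (hS1 : volume S ≠ ∞) :
    μ {L | HasRelation k S (Quotient.out (α := SLR n) L)} ≤
      (k.factorial : ℝ≥0∞)⁻¹ *
        ∑' q : ℕ, (2 * q + 1 : ℝ≥0∞) ^ k * (2 * volume S ^ k * relationWeight n q) := by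
  choose B W hWo hW hWv hB using fun τ : RelationType k => τ.2.exists_isOpen hS hS0 hS1
  have hmeas := fun τ => measurable_latticeSum_inter_linearIndependent (hWo τ)
  have hfac : (k.factorial : ℝ≥0∞) ≠ 0 := by exact_mod_cast k.factorial_ne_zero
  have hfac' : (k.factorial : ℝ≥0∞) ≠ ∞ := ENNReal.natCast_ne_top _
  have : Countable (RelationType k) := inferInstance
  have h1 : (k.factorial : ℝ≥0∞) * μ {L | HasRelation k S (Quotient.out (α := SLR n) L)} ≤
      ∑' q : ℕ, (2 * q + 1 : ℝ≥0∞) ^ k * (2 * volume S ^ k * relationWeight n q) :=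
    calc _ ≤ (k.factorial : ℝ≥0∞) * μ {L | (k.factorial : ℝ≥0∞) ≤
          ∑' τ, latticeSum ((W τ ∩ {y | LinearIndependent ℝ y}).indicator 1) L} := by
          gcongr
          exact fun hL => factorial_le_tsum_latticeSum hW hB hL
      _ ≤ ∫⁻ L, ∑' τ, latticeSum ((W τ ∩ {y | LinearIndependent ℝ y}).indicator 1) L ∂μ :=
          mul_meas_ge_le_lintegral (Measurable.tsum hmeas) _
      _ = ∑' τ, ∫⁻ L, latticeSum ((W τ ∩ {y | LinearIndependent ℝ y}).indicator 1) L ∂μ :=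
          lintegral_tsum fun τ => (hmeas τ).aemeasurable
      _ ≤ ∑' τ : RelationType k, 2 * volume S ^ k * relationWeight n τ.1.1 :=
          ENNReal.tsum_le_tsum fun τ =>
            (lintegral_latticeSum_indicator_le hμ hk hkn (hWo τ)).trans (hWv τ)
      _ ≤ _ := tsum_relationType_le fun q => 2 * volume S ^ k * relationWeight n q
  calc _ = (k.factorial : ℝ≥0∞)⁻¹ * ((k.factorial : ℝ≥0∞) *
        μ {L | HasRelation k S (Quotient.out (α := SLR n) L)}) := by
        rw [← mul_assoc, ENNReal.inv_mul_cancel hfac hfac', one_mul]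
    _ ≤ _ := by gcongr

end measureHasRelation

section hasRelation

variable {n k : ℕ} {S : Set (Fin n → ℝ)}

theorem exists_primitive_relation {v : Fin (k + 1) → Fin n → ℤ} (hv : ¬LinearIndependent ℤ v) :
    ∃ b : Fin (k + 1) → ℤ, ∑ i, b i • v i = 0 ∧ (∃ i, b i ≠ 0) ∧ Finset.univ.gcd b = 1 := by
  obtain ⟨c, hc, i, hi⟩ := Fintype.not_linearIndependent_iff.1 hv
  obtain ⟨b, hb, hgcd⟩ := Finset.extract_gcd c (Finset.univ_nonempty (α := Fin (k + 1)))
  have hb' : ∀ i, c i = Finset.univ.gcd c * b i := fun i => hb i (Finset.mem_univ i)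
  have hg0 : Finset.univ.gcd c ≠ 0 := fun h => hi (by rw [hb' i, h, zero_mul])
  refine ⟨b, ?_, ⟨i, fun h => hi (by rw [hb' i, h, mul_zero])⟩, hgcd⟩
  have : Finset.univ.gcd c • ∑ i, b i • v i = 0 := by
    rw [Finset.smul_sum, ← hc]
    exact Finset.sum_congr rfl fun i _ => by rw [smul_smul, ← hb' i]
  exact (smul_eq_zero.1 this).resolve_left hg0

theorem mulVec_sum_cast (g : Matrix (Fin n) (Fin n) ℝ) (a : Fin k → ℤ) (v : Fin k → Fin n → ℤ)
    {q : ℤ} {u : Fin n → ℤ} (h : ∀ j, q * u j = ∑ i, a i * v i j) :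
    (q : ℝ) • g.mulVec (fun j => (u j : ℝ)) = ∑ i, (a i : ℝ) • tupleAct g (tupleCast v) i := by
  have : (q : ℝ) • (fun j => (u j : ℝ)) = ∑ i, (a i : ℝ) • tupleCast v i := by
    funext j
    rw [Finset.sum_apply]
    simpa [tupleCast] using congrArg (Int.cast : ℤ → ℝ) (h j)
  rw [← Matrix.mulVec_smul, this, Matrix.mulVec_sum]
  exact Finset.sum_congr rfl fun i _ => Matrix.mulVec_smul ..

theorem exists_ne_zero_of_sum_mem (hSS : S ∩ -S = ∅) {y : Fin k → Fin n → ℝ} {x : Fin n → ℝ}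
    (hy : ∀ i, y i ∈ S) (hx : x ∈ S) (hxy : ∀ i, y i ≠ x) {a : Fin k → ℤ} (ha : ∀ i, |a i| ≤ 1)
    (h : x = ∑ i, (a i : ℝ) • y i) : ∃ i j, i ≠ j ∧ a i ≠ 0 ∧ a j ≠ 0 := by
  have hS : ∀ z ∈ S, -z ∉ S := fun z hz hz' => by
    have : z ∈ S ∩ -S := ⟨hz, hz'⟩
    rw [hSS] at this
    exact this
  by_contra! hcon
  by_cases h0 : ∀ i, a i = 0
  · have : x = 0 := by simp [h, h0]
    exact hS x hx (by rwa [this, neg_zero, ← this])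
  · push Not at h0
    obtain ⟨i, hi⟩ := h0
    rw [Finset.sum_eq_single i (fun j _ hj => by simp [hcon i j hj.symm hi]) (by simp)] at h
    rcases (abs_eq zero_le_one).1 (le_antisymm (ha i) (Int.one_le_abs hi)) with h1 | h1
    · exact hxy i (by simp [h, h1])
    · exact hS (y i) (hy i) (by convert hx using 1; simp [h, h1])

theorem linearIndependent_succAbove {y : Fin (k + 1) → Fin n → ℝ} {i₀ : Fin (k + 1)}
    (hrank : k ≤ Module.finrank ℝ (Submodule.span ℝ (Set.range y)))
    (hmem : y i₀ ∈ Submodule.span ℝ (Set.range fun i => y (i₀.succAbove i))) :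
    LinearIndependent ℝ fun i => y (i₀.succAbove i) := by
  rw [linearIndependent_iff_card_le_finrank_span, Fintype.card_fin]
  refine hrank.trans (Submodule.finrank_mono (Submodule.span_le.2 ?_))
  rintro _ ⟨i, rfl⟩
  rcases Fin.eq_self_or_eq_succAbove i₀ i with rfl | ⟨j, rfl⟩
  · exact hmem
  · exact Submodule.subset_span ⟨j, rfl⟩

theorem exists_relation_succAbove {v : Fin (k + 1) → Fin n → ℤ} (hv : ¬LinearIndependent ℤ v) :
    ∃ (q : ℕ) (a : Fin k → ℤ) (i₀ : Fin (k + 1)), 0 < q ∧ (∀ i, |a i| ≤ q) ∧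
      (∀ d : ℤ, d ∣ q → (∀ i, d ∣ a i) → IsUnit d) ∧
      ∀ j, (q : ℤ) * v i₀ j = ∑ i, a i * v (i₀.succAbove i) j := by
  obtain ⟨b, hb, ⟨i, hi⟩, hgcd⟩ := exists_primitive_relation hv
  obtain ⟨i₀, -, hmax⟩ :=
    Finset.exists_max_image Finset.univ (fun i => |b i|) ⟨i, Finset.mem_univ i⟩
  have hb0 : b i₀ ≠ 0 := abs_pos.1 ((abs_pos.2 hi).trans_le (hmax i (Finset.mem_univ i)))
  obtain ⟨s, hs, hqs⟩ : ∃ s : ℤ, |s| = 1 ∧ ((b i₀).natAbs : ℤ) = s * b i₀ := by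
    rcases lt_or_gt_of_ne hb0 with h | h
    · exact ⟨-1, by simp, by rw [Int.natCast_natAbs, abs_of_neg h]; ring⟩
    · exact ⟨1, by simp, by rw [Int.natCast_natAbs, abs_of_pos h]; ring⟩
  have habs : ∀ i, |-s * b (i₀.succAbove i)| = |b (i₀.succAbove i)| := fun i => by
    rw [abs_mul, abs_neg, hs, one_mul]
  refine ⟨(b i₀).natAbs, fun i => -s * b (i₀.succAbove i), i₀, Int.natAbs_pos.2 hb0,
    fun i => ?_, fun d hd hda => ?_, fun j => ?_⟩
  · rw [habs, Int.natCast_natAbs]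
    exact hmax _ (Finset.mem_univ _)
  · refine isUnit_of_dvd_one (hgcd ▸ Finset.dvd_gcd fun i _ => ?_)
    rcases Fin.eq_self_or_eq_succAbove i₀ i with rfl | ⟨j, rfl⟩
    · exact Int.dvd_natAbs.1 hd
    · exact (dvd_abs _ _).1 (habs j ▸ (dvd_abs _ _).2 (hda j))
  · have h := congrFun hb j
    rw [Fin.sum_univ_succAbove _ i₀] at h
    simp only [Pi.add_apply, Finset.sum_apply, Pi.smul_apply, smul_eq_mul, Pi.zero_apply] at h
    simp only [hqs, mul_assoc, ← Finset.mul_sum]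
    linear_combination s * h

theorem hasRelation_of_not_linearIndependent (hSS : S ∩ -S = ∅) (g : SLR n)
    {v : Fin (k + 1) → Fin n → ℤ} (hinj : Function.Injective (tupleAct g.1 (tupleCast v)))
    (hS : ∀ i, tupleAct g.1 (tupleCast v) i ∈ S)
    (hrank : k ≤ Module.finrank ℝ (Submodule.span ℝ (Set.range (tupleAct g.1 (tupleCast v)))))
    (hv : ¬LinearIndependent ℝ (tupleAct g.1 (tupleCast v))) : HasRelation k S g := by
  have hvZ : ¬LinearIndependent ℤ v := fun h => hv <| by
    have h1 : LinearIndependent ℝ (tupleCast v) :=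
      linearIndependent_algebraMap_comp_iff (R := ℤ) (S := ℝ).2 h
    refine h1.map' (Matrix.mulVecLin g.1) (LinearMap.ker_eq_bot.2 ?_)
    exact Matrix.mulVec_injective_of_isUnit
      ((Matrix.isUnit_iff_isUnit_det _).2 (by rw [g.2]; exact isUnit_one))
  obtain ⟨q, a, i₀, hq, habs, hunit, huv⟩ := exists_relation_succAbove hvZ
  have hrel : (q : ℝ) • tupleAct g.1 (tupleCast v) i₀ =
      ∑ i, (a i : ℝ) • tupleAct g.1 (tupleCast v) (i₀.succAbove i) := by
    have := mulVec_sum_cast g.1 a (fun i => v (i₀.succAbove i)) huv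
    rw [Int.cast_natCast] at this
    exact this
  have hq' : (q : ℝ) ≠ 0 := by exact_mod_cast hq.ne'
  have hact : tupleAct g.1 (tupleCast fun i => v (i₀.succAbove i)) =
      fun i => tupleAct g.1 (tupleCast v) (i₀.succAbove i) := rfl
  have hcast : g.1.mulVec (fun j => (v i₀ j : ℝ)) = tupleAct g.1 (tupleCast v) i₀ := rfl
  refine ⟨q, a, fun i => v (i₀.succAbove i), v i₀, ⟨hq, habs, hunit, ?_⟩, ?_, ?_, ?_, huv⟩
  · rintro rfl
    refine exists_ne_zero_of_sum_mem hSS (fun i => hS (i₀.succAbove i)) (hS i₀)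
      (fun i h => Fin.succAbove_ne i₀ i (hinj h)) (by simpa using habs) ?_
    rwa [Nat.cast_one, one_smul] at hrel
  · rw [hact]
    refine linearIndependent_succAbove hrank ?_
    rw [← inv_smul_smul₀ hq' (tupleAct g.1 (tupleCast v) i₀), hrel]
    exact Submodule.smul_mem _ _ (Submodule.sum_mem _ fun i _ =>
      Submodule.smul_mem _ _ (Submodule.subset_span ⟨i, rfl⟩))
  · rw [hact]
    exact fun i => hS _
  · rw [hcast]
    exact hS i₀

theorem hasRelation_of_dCount_pos (hSS : S ∩ -S = ∅) (hk : 1 ≤ k) {L : LatticeSpace n}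
    (h : 0 < dCount k (latticeOf L ∩ S)) : HasRelation k S (Quotient.out (α := SLR n) L) := by
  obtain ⟨Y, hYA, hYk, hYi, X, hYX, hXA, hXk⟩ := Set.nonempty_of_ncard_ne_zero h.ne'
  obtain ⟨x, hxX, hxY⟩ := Set.exists_of_ssubset hYX
  have hYfin : Y.Finite := Set.finite_of_ncard_ne_zero (by omega)
  have : Finite Y := hYfin
  let e : Y ≃ Fin k := Finite.equivFinOfCardEq hYk
  let y : Fin k → Fin n → ℝ := fun i => e.symm i
  have hy : LinearIndependent ℝ y := hYi.comp e.symm e.symm.injective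
  have hyY : Set.range y = Y := by
    have : y = Subtype.val ∘ e.symm := rfl
    rw [this, Set.range_comp, e.symm.range_eq_univ, Set.image_univ, Subtype.range_coe]
  have hrank : Module.finrank ℝ (Submodule.span ℝ (Set.range y)) = k := by
    rw [finrank_span_eq_card hy, Fintype.card_fin]
  have hxspan : x ∈ Submodule.span ℝ (Set.range y) := by
    have hle : Submodule.span ℝ (Set.range y) ≤ Submodule.span ℝ X := by
      rw [hyY]
      exact Submodule.span_mono hYX.1
    rw [Submodule.eq_of_le_of_finrank_eq hle (hrank.trans hXk.symm)]
    exact Submodule.subset_span hxX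
  let z : Fin (k + 1) → Fin n → ℝ := Fin.cons x y
  have hzA : ∀ i, z i ∈ latticeOf L ∩ S := Fin.cases (hXA hxX) fun i => hYA (e.symm i).2
  choose v hv using fun i => (hzA i).1
  have hz : tupleAct (Quotient.out (α := SLR n) L).1 (tupleCast v) = z :=
    funext fun i => (hv i).symm
  refine hasRelation_of_not_linearIndependent hSS _ (v := v) ?_ ?_ ?_ ?_
  · rw [hz, Fin.cons_injective_iff]
    exact ⟨by rwa [hyY], hy.injective⟩
  · rw [hz]
    exact fun i => (hzA i).2
  · rw [hz, Fin.range_cons]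
    exact hrank.symm.le.trans (Submodule.finrank_mono (Submodule.span_mono (Set.subset_insert _ _)))
  · rw [hz, linearIndependent_finCons]
    exact fun h => h.2 hxspan

end hasRelation

section numerics

variable {n k : ℕ}

theorem half_pow_le {d : ℕ} (h : n ≤ 2 * d) : (1 / 2 : ℝ) ^ d ≤ (√3 / 2) ^ n := by
  have h3 : (√3 / 2) ^ 2 = 3 / 4 := by
    rw [div_pow, Real.sq_sqrt (by norm_num)]
    norm_num
  refine le_of_sq_le_sq ?_ (by positivity)
  calc ((1 / 2 : ℝ) ^ d) ^ 2 = (1 / 2) ^ (2 * d) := by rw [← pow_mul, mul_comm]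
    _ ≤ (1 / 2) ^ n := pow_le_pow_of_le_one (by norm_num) (by norm_num) h
    _ ≤ (3 / 4) ^ n := pow_le_pow_left₀ (by norm_num) (by norm_num) n
    _ = ((√3 / 2) ^ n) ^ 2 := by rw [← h3, ← pow_mul, ← pow_mul, mul_comm]

theorem inv_pow_le {q : ℕ} (hq : 2 ≤ q) (hkn : 2 * k + 4 ≤ n) :
    (2 * q + 1 : ℝ) ^ k * ((q : ℝ) ^ n)⁻¹ ≤ 4 * 3 ^ k * (√3 / 2) ^ n / (q : ℝ) ^ 2 := by
  obtain ⟨d, rfl⟩ : ∃ d, n = k + 2 + d := ⟨n - k - 2, by omega⟩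
  have hq2 : (2 : ℝ) ≤ q := by exact_mod_cast hq
  have hd : ((q : ℝ) ^ d)⁻¹ ≤ 4 * (√3 / 2) ^ (k + 2 + d) := by
    have h1 : (1 / 2 : ℝ) ^ (d + 2) ≤ (√3 / 2) ^ (k + 2 + d) := half_pow_le (by omega)
    calc ((q : ℝ) ^ d)⁻¹ ≤ ((2 : ℝ) ^ d)⁻¹ := by gcongr
      _ = 4 * (1 / 2) ^ (d + 2) := by rw [pow_add, one_div, inv_pow]; ring
      _ ≤ _ := by gcongr
  have hk : (2 * q + 1 : ℝ) ^ k ≤ 3 ^ k * (q : ℝ) ^ k := by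
    rw [← mul_pow]
    gcongr
    linarith
  have h0 : (0 : ℝ) < q := by linarith
  calc (2 * q + 1 : ℝ) ^ k * ((q : ℝ) ^ (k + 2 + d))⁻¹
      ≤ 3 ^ k * (q : ℝ) ^ k * ((q : ℝ) ^ (k + 2 + d))⁻¹ := by gcongr
    _ = 3 ^ k * ((q : ℝ) ^ d)⁻¹ / (q : ℝ) ^ 2 := by
        rw [pow_add, pow_add]
        field_simp
    _ ≤ 3 ^ k * (4 * (√3 / 2) ^ (k + 2 + d)) / (q : ℝ) ^ 2 := by gcongr
    _ = _ := by ring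

theorem mul_relationWeight_le (hkn : 2 * k + 4 ≤ n) (q : ℕ) :
    (2 * q + 1 : ℝ≥0∞) ^ k * relationWeight n q ≤
      ENNReal.ofReal (4 * 3 ^ k * (√3 / 2) ^ n / (q : ℝ) ^ 2) := by
  rw [relationWeight]
  split_ifs with h0 h1
  · simp
  · subst h1
    have h3 : (2 * (1 : ℕ) + 1 : ℝ≥0∞) = ENNReal.ofReal 3 := by
      rw [ENNReal.ofReal_ofNat]
      norm_num
    rw [h3, youngConst, ← ENNReal.ofReal_pow (by norm_num), ← ENNReal.ofReal_pow (by positivity),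
      ← ENNReal.ofReal_mul (by positivity)]
    refine ENNReal.ofReal_le_ofReal ?_
    have : 0 ≤ (3 : ℝ) ^ k * (√3 / 2) ^ n := by positivity
    rw [Nat.cast_one, one_pow, div_one]
    linarith
  · have hq : 2 ≤ q := by omega
    have hq0 : (0 : ℝ) < q := by exact_mod_cast (by omega : 0 < q)
    have h2 : (2 * q + 1 : ℝ≥0∞) = ENNReal.ofReal (2 * q + 1) := by
      rw [ENNReal.ofReal_add (by positivity) zero_le_one, ENNReal.ofReal_mul zero_le_two]
      simp
    rw [h2, ← ENNReal.ofReal_natCast q, ← ENNReal.ofReal_pow hq0.le,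
      ← ENNReal.ofReal_inv_of_pos (pow_pos hq0 _), ← ENNReal.ofReal_pow (by positivity),
      ← ENNReal.ofReal_mul (by positivity)]
    exact ENNReal.ofReal_le_ofReal (inv_pow_le hq hkn)

theorem tsum_mul_relationWeight_le (hkn : 2 * k + 4 ≤ n) {v : ℝ} (hv : 0 ≤ v) :
    (k.factorial : ℝ≥0∞)⁻¹ * ∑' q : ℕ, (2 * q + 1 : ℝ≥0∞) ^ k *
        (2 * ENNReal.ofReal v ^ k * relationWeight n q) ≤
      ENNReal.ofReal (8 * (∑' q : ℕ, 1 / (q : ℝ) ^ 2) * (√3 / 2) ^ n *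
        ((3 * v) ^ k / k.factorial)) := by
  have hZ : Summable fun q : ℕ => 1 / (q : ℝ) ^ 2 :=
    Real.summable_one_div_nat_pow.2 one_lt_two
  have hterm : ∀ q : ℕ, (2 * q + 1 : ℝ≥0∞) ^ k * (2 * ENNReal.ofReal v ^ k * relationWeight n q) ≤
      ENNReal.ofReal (8 * (3 * v) ^ k * (√3 / 2) ^ n) * ENNReal.ofReal (1 / (q : ℝ) ^ 2) := fun q =>
    calc _ = 2 * ENNReal.ofReal v ^ k * ((2 * q + 1 : ℝ≥0∞) ^ k * relationWeight n q) := by ring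
      _ ≤ 2 * ENNReal.ofReal v ^ k * ENNReal.ofReal (4 * 3 ^ k * (√3 / 2) ^ n / (q : ℝ) ^ 2) := by
          gcongr
          exact mul_relationWeight_le hkn q
      _ = _ := by
          rw [← ENNReal.ofReal_pow hv, ← ENNReal.ofReal_ofNat 2, ← ENNReal.ofReal_mul zero_le_two,
            ← ENNReal.ofReal_mul (by positivity), ← ENNReal.ofReal_mul (by positivity)]
          congr 1
          ring
  have hfac : (0 : ℝ) < k.factorial := by exact_mod_cast k.factorial_pos
  refine (mul_le_mul_right (ENNReal.tsum_le_tsum hterm) _).trans_eq ?_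
  rw [ENNReal.tsum_mul_left, ← ENNReal.ofReal_tsum_of_nonneg (fun q => by positivity) hZ,
    ← ENNReal.ofReal_natCast, ← ENNReal.ofReal_inv_of_pos hfac,
    ← ENNReal.ofReal_mul (by positivity),
    ← ENNReal.ofReal_mul (by positivity)]
  congr 1
  ring

theorem exp_mul_sqrt_lt_one : Real.exp (1 / 10) * (√3 / 2) < 1 := by
  have h3 : √3 ^ 2 = 3 := Real.sq_sqrt (by norm_num)
  have h10 : (Real.exp (1 / 10) * (√3 / 2)) ^ 10 = Real.exp 1 * (3 / 4) ^ 5 := by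
    rw [mul_pow, ← Real.exp_nat_mul, div_pow, show √3 ^ 10 = (√3 ^ 2) ^ 5 by ring, h3]
    norm_num
  refine lt_of_pow_lt_pow_left₀ 10 zero_le_one ?_
  rw [h10, one_pow]
  have := Real.exp_one_lt_d9
  norm_num
  linarith

end numerics

/-- **Estimate (2.5).** There are universal constants `c, C > 0` such that if `S ⊆ ℝⁿ`
is a Borel set with `S ∩ (-S) = ∅` and `0 < Vol(S) ≤ n/30`, and `μ` is an
`SL(n,ℝ)`-invariant Borel probability measure on the space of covolume-one lattices,
then `μ(∃ k, 1 ≤ k ≤ n/10 and d_k(L ∩ S) > 0) ≤ C e^{-cn}` (the event being taken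
within the full-measure set of lattices with `L ∩ S` finite). -/
theorem prob_exists_dCount_pos_le :
    ∃ c C : ℝ, 0 < c ∧ 0 < C ∧
      ∀ n : ℕ, 1 ≤ n →
      ∀ S : Set (Fin n → ℝ), MeasurableSet S → S ∩ (-S) = ∅ →
        0 < volume S → volume S ≤ ENNReal.ofReal ((n : ℝ) / 30) →
      ∀ μ : Measure (LatticeSpace n), IsProbabilityMeasure μ →
        (∀ g : SLR n, Measure.map (fun x => g • x) μ = μ) →
        μ {L : LatticeSpace n | (latticeOf L ∩ S).Finite ∧
            ∃ k : ℕ, 1 ≤ k ∧ (k : ℝ) ≤ (n : ℝ) / 10 ∧ 0 < dCount k (latticeOf L ∩ S)}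
          ≤ ENNReal.ofReal (C * Real.exp (-(c * n))) := by
  have hr : 0 < Real.exp (1 / 10) * (√3 / 2) := by positivity
  have hZ : 0 < ∑' q : ℕ, 1 / (q : ℝ) ^ 2 :=
    (Real.summable_one_div_nat_pow.2 one_lt_two).tsum_pos (fun q => by positivity) 1 (by norm_num)
  refine ⟨-Real.log (Real.exp (1 / 10) * (√3 / 2)), 8 * ∑' q : ℕ, 1 / (q : ℝ) ^ 2,
    neg_pos.2 (Real.log_neg hr exp_mul_sqrt_lt_one), by positivity, ?_⟩
  intro n _ S hS hSS hS0 hSn μ _ hμ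
  have hS1 : volume S ≠ ∞ := (hSn.trans_lt ENNReal.ofReal_lt_top).ne
  obtain ⟨v, hv0, hv⟩ : ∃ v : ℝ, 0 ≤ v ∧ volume S = ENNReal.ofReal v :=
    ⟨(volume S).toReal, ENNReal.toReal_nonneg, (ENNReal.ofReal_toReal hS1).symm⟩
  have hvn : v ≤ n / 30 := by
    rw [hv] at hSn
    exact (ENNReal.ofReal_le_ofReal_iff (by positivity)).1 hSn
  set Z := ∑' q : ℕ, 1 / (q : ℝ) ^ 2
  calc _ ≤ μ (⋃ k ∈ Finset.Icc 1 (n / 10),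
        {L | HasRelation k S (Quotient.out (α := SLR n) L)}) := by
        refine measure_mono ?_
        rintro L ⟨-, k, hk, hkn, hd⟩
        have hkn' : 10 * k ≤ n := by
          have : (10 * k : ℝ) ≤ n := by linarith
          exact_mod_cast this
        exact Set.mem_biUnion (Finset.mem_coe.2 (Finset.mem_Icc.2 ⟨hk, by omega⟩))
          (hasRelation_of_dCount_pos hSS hk hd)
    _ ≤ ∑ k ∈ Finset.Icc 1 (n / 10), μ {L | HasRelation k S (Quotient.out (α := SLR n) L)} :=
        measure_biUnion_finset_le _ _
    _ ≤ ∑ k ∈ Finset.Icc 1 (n / 10),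
        ENNReal.ofReal (8 * Z * (√3 / 2) ^ n * ((3 * v) ^ k / k.factorial)) := by
        refine Finset.sum_le_sum fun k hk => ?_
        rw [Finset.mem_Icc] at hk
        refine (measure_hasRelation_le hμ hk.1 (by omega) hS hS0.ne' hS1).trans ?_
        rw [hv]
        exact tsum_mul_relationWeight_le (by omega) hv0
    _ = ENNReal.ofReal (8 * Z * (√3 / 2) ^ n *
        ∑ k ∈ Finset.Icc 1 (n / 10), (3 * v) ^ k / k.factorial) := by
        rw [Finset.mul_sum, ENNReal.ofReal_sum_of_nonneg fun k _ => by positivity]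
    _ ≤ _ := by
        refine ENNReal.ofReal_le_ofReal ?_
        have hexp : ∑ k ∈ Finset.Icc 1 (n / 10), (3 * v) ^ k / k.factorial ≤
            Real.exp (n / 10) := by
          refine le_trans (Finset.sum_le_sum_of_subset_of_nonneg (t := Finset.range (n / 10 + 1))
            (fun k hk => ?_) fun k _ _ => by positivity) ((Real.sum_le_exp_of_nonneg
              (by positivity) _).trans (Real.exp_le_exp.2 (by linarith)))
          rw [Finset.mem_Icc] at hk
          exact Finset.mem_range.2 (by omega)
        have hpow : Real.exp (-(-Real.log (Real.exp (1 / 10) * (√3 / 2)) * n)) =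
            (√3 / 2) ^ n * Real.exp (n / 10) := by
          rw [neg_mul, neg_neg, mul_comm, Real.exp_nat_mul, Real.exp_log hr, mul_pow,
            ← Real.exp_nat_mul, mul_comm]
          congr 2
          ring
        rw [hpow, ← mul_assoc]
        gcongr
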